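/- Every Niemeier lattice Λ with no roots has covering radius at most √2: extending the bilinear form B of Λ to a real bilinear form on Λ ⊗ ℝ, for every x ∈ Λ ⊗ ℝ there exists λ ∈ Λ with B(x − λ, x − λ) ≤ 2. -/

import Mathlib

section

theorem exists_isotropic_of_nonpos {I : Type*} [Fintype I] [DecidableEq I]
    (f : LinearMap.BilinForm ℤ (I → ℤ)) (hs : ∀ x y, f x y = f y x)
    (h2 : ∀ i, f (Pi.single i 1) (Pi.single i 1) = 2)
    (hlo : ∀ i j, -2 ≤ f (Pi.single i 1) (Pi.single j 1))
    (hb : ∃ b : I → ℤ, 0 ≤ b ∧ b ≠ 0 ∧ f b b ≤ 0) :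
    ∃ b : I → ℤ, 0 ≤ b ∧ b ≠ 0 ∧ f b b = 0 ∧ ∀ i, 0 < b i → f b (Pi.single i 1) = 0 := by
  set r : I → (I → ℤ) := fun i => Pi.single i 1 with hr
  have hexp : ∀ x y, f y x = ∑ i, x i * f y (r i) := by
    intro x y
    rw [LinearMap.pi_apply_eq_sum_univ (f y) x]
    simp only [smul_eq_mul, hr]
    refine Finset.sum_congr rfl fun i _ => ?_
    congr 2
    ext j
    simp [Pi.single_apply, eq_comm]
  have hadd : ∀ x y, f (x + y) (x + y) = f x x + 2 * f x y + f y y := by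
    intro x y
    simp only [map_add, LinearMap.add_apply]
    rw [hs y x]; ring
  have hsub : ∀ x y, f (x - y) (x - y) = f x x - 2 * f x y + f y y := by
    intro x y
    simp only [map_sub, LinearMap.sub_apply]
    rw [hs y x]; ring
  obtain ⟨x, ⟨hx0, hxne, hxn⟩, hxm⟩ := WellFounded.has_min
    (InvImage.wf (fun b : I → ℤ => (∑ i, b i).toNat) Nat.lt_wfRel.wf)
    {b : I → ℤ | 0 ≤ b ∧ b ≠ 0 ∧ f b b ≤ 0} hb
  have hmin : ∀ y, 0 ≤ y → y ≠ 0 → y ≤ x → y ≠ x → 0 < f y y := by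
    intro y hy0 hy hyx hne
    by_contra! hc
    apply hxm y ⟨hy0, hy, hc⟩
    have h1 : ∑ i, y i < ∑ i, x i := by
      apply Finset.sum_lt_sum (fun i _ => hyx i)
      by_contra! h
      exact hne (le_antisymm hyx fun i => h i (Finset.mem_univ i))
    have h0 : 0 ≤ ∑ i, y i := Finset.sum_nonneg fun i _ => hy0 i
    change (∑ i, y i).toNat < (∑ i, x i).toNat
    omega
  have hr0 : ∀ i, 0 ≤ r i := fun i => Pi.single_nonneg.2 zero_le_one
  have hrne : ∀ i, r i ≠ 0 := fun i h => by simpa [hr] using congrFun h i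
  have hrle : ∀ (z : I → ℤ) i, 0 ≤ z → 0 < z i → r i ≤ z := by
    intro z i hz hi j
    simp only [hr, Pi.single_apply]
    split_ifs with h
    · subst h; exact hi
    · exact hz j
  have hle : ∀ i, 0 < x i → f x (r i) ≤ 0 := by
    intro i hi
    have hri := hrle x i hx0 hi
    by_cases he : r i = x
    · rw [← he] at hxn; have := h2 i; simp only [hr] at hxn; omega
    have := hmin (x - r i) (sub_nonneg.2 hri) (fun h => he (sub_eq_zero.1 h).symm)
      (sub_le_self _ (hr0 i)) (fun h => hrne i (by simpa using h))
    rw [hsub] at this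
    have := h2 i
    simp only [hr] at *
    omega
  rcases hxn.lt_or_eq with hlt | heq
  · exfalso
    obtain ⟨i0, hi0⟩ : ∃ i, 0 < x i := by
      by_contra! h
      exact hxne (le_antisymm h hx0)
    obtain ⟨β, ⟨⟨hβ0, hβx⟩, hβne, hβ2, hβI⟩, hβm⟩ := Set.exists_max_image
      {β : I → ℤ | β ∈ Set.Icc 0 x ∧ β ≠ 0 ∧ f β β = 2 ∧ ∀ j, β + r j ≤ x → -2 ≤ f β (r j)}
      (fun b => ∑ i, b i) ((Set.finite_Icc 0 x).subset fun _ h => h.1)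
      ⟨r i0, ⟨hr0 _, hrle x i0 hx0 hi0⟩, hrne _, h2 _, fun j _ => hlo _ _⟩
    have h1 : f β x ≤ 0 := by
      rw [hs, hexp]
      apply Finset.sum_nonpos
      intro i _
      rcases (hx0 i).lt_or_eq with h | h
      · exact mul_nonpos_of_nonneg_of_nonpos (hβ0 i) (hle i h)
      · have : β i = 0 := le_antisymm (by rw [show (0:ℤ) = x i from h]; exact hβx i) (hβ0 i)
        simp [this]
    have h3 : f β (x - β) < 0 := by rw [map_sub]; omega
    rw [hexp] at h3
    obtain ⟨j, -, hj⟩ := Finset.exists_lt_of_sum_lt (g := fun _ => (0:ℤ)) (s := Finset.univ)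
      (by simpa using h3)
    have hxβ : 0 ≤ x - β := sub_nonneg.2 hβx
    have hj1 : 0 < (x - β) j := by
      rcases (hxβ j).lt_or_eq with h | h
      · exact h
      · rw [← Pi.sub_apply, ← h] at hj
        simp at hj
    have hj2 : f β (r j) < 0 := by
      by_contra! h
      exact absurd (mul_nonneg hj1.le h) (not_le.2 hj)
    have hjx : β + r j ≤ x := by
      have := hrle _ j hxβ hj1
      exact add_le_of_le_sub_left this
    have hne0 : ∀ z w : I → ℤ, 0 ≤ z → 0 ≤ w → z ≠ 0 → z + w ≠ 0 := by
      intro z w hz hw hzn h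
      exact hzn (le_antisymm (fun i => by have := congrFun h i; have := hw i; simp at *; omega) hz)
    have hjI := hβI j hjx
    have h2j := h2 j
    change f (r j) (r j) = 2 at h2j
    have hj3 : f β (r j) = -1 := by
      by_contra h
      have h4 : f β (r j) = -2 := by omega
      have h5 : f (β + r j) (β + r j) = 0 := by rw [hadd]; omega
      have h6 : β + r j = x := by
        by_contra h6
        have := hmin _ (add_nonneg hβ0 (hr0 j)) (hne0 _ _ hβ0 (hr0 j) hβne) hjx h6
        omega
      rw [h6] at h5; omega
    have hmem : β + r j ∈ {β : I → ℤ | β ∈ Set.Icc 0 x ∧ β ≠ 0 ∧ f β β = 2 ∧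
        ∀ j, β + r j ≤ x → -2 ≤ f β (r j)} := by
      refine ⟨⟨add_nonneg hβ0 (hr0 j), hjx⟩, hne0 _ _ hβ0 (hr0 j) hβne, by rw [hadd]; omega, ?_⟩
      intro k hk
      have hkx : β + r k ≤ x := le_trans (by
        rw [add_right_comm]; exact le_add_of_nonneg_right (hr0 j)) hk
      have hpos1 := hmin (β + r k) (add_nonneg hβ0 (hr0 k)) (hne0 _ _ hβ0 (hr0 k) hβne) hkx (by
        intro h
        rw [add_right_comm, h] at hk
        exact hrne j (le_antisymm (by simpa using hk) (hr0 j)))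
      rw [hadd] at hpos1
      have h2k := h2 k
      change f (r k) (r k) = 2 at h2k
      have hjk := hmin (r j + r k) (add_nonneg (hr0 j) (hr0 k)) (hne0 _ _ (hr0 j) (hr0 k) (hrne j))
        (le_trans (by rw [add_assoc]; exact le_add_of_nonneg_left hβ0) hk) (by
        intro h
        rw [add_assoc, h] at hk
        exact hβne (le_antisymm (by simpa using hk) hβ0))
      rw [hadd] at hjk
      rw [map_add, LinearMap.add_apply]
      omega
    have := hβm _ hmem
    simp [Finset.sum_add_distrib, hr] at this
  · refine ⟨x, hx0, hxne, heq, ?_⟩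
    intro i hi
    rw [hexp] at heq
    have := (Finset.sum_eq_zero_iff_of_nonpos (s := Finset.univ)
      (f := fun i => x i * f x (r i)) (fun i _ => by
        rcases (hx0 i).lt_or_eq with h | h
        · exact mul_nonpos_of_nonneg_of_nonpos (hx0 i) (hle i h)
        · rw [← h]; simp)).1 heq i (Finset.mem_univ i)
    rcases mul_eq_zero.1 this with h | h
    · omega
    · exact h

open scoped RealInnerProductSpace

/-- A finite simply-laced root system `R` with heights `t` valued in `{1, …, H - 1}`, additive
modulo `H`. -/
structure HeightedRoots {E : Type*} [NormedAddCommGroup E] [InnerProductSpace ℝ E]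
    (R : Finset E) (t : E → ℤ) (H : ℤ) : Prop where
  norm_two : ∀ α ∈ R, ⟪α, α⟫ = 2
  neg_mem : ∀ α ∈ R, -α ∈ R
  integral : ∀ α ∈ R, ∀ β ∈ R, ∃ n : ℤ, ⟪α, β⟫ = n
  sub_mem : ∀ α ∈ R, ∀ β ∈ R, ⟪α, β⟫ = 1 → α - β ∈ R
  pos : ∀ α ∈ R, 0 < t α
  lt : ∀ α ∈ R, t α < H
  neg : ∀ α ∈ R, t (-α) = H - t α
  add : ∀ α ∈ R, ∀ β ∈ R, α + β ∈ R → H ∣ t (α + β) - (t α + t β)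

namespace HeightedRoots

variable {E : Type*} [NormedAddCommGroup E] [InnerProductSpace ℝ E]
  {R : Finset E} {t : E → ℤ} {H : ℤ}

/-- Roots that are not sums of two roots with additive heights. -/
def IsSimple (R : Finset E) (t : E → ℤ) (s : E) : Prop :=
  s ∈ R ∧ ∀ α ∈ R, ∀ β ∈ R, s = α + β → t s ≠ t α + t β

theorem exists_multiset (h : HeightedRoots R t H) (α : E) (hα : α ∈ R) :
    ∃ m : Multiset E, (∀ s ∈ m, IsSimple R t s) ∧ m.sum = α ∧ (m.map t).sum = t α := by
  induction hn : (t α).toNat using Nat.strong_induction_on generalizing α with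
  | _ n ih =>
    by_cases hs : IsSimple R t α
    · exact ⟨{α}, by simpa using hs, by simp, by simp⟩
    · simp only [IsSimple, hα, true_and, not_forall, not_not] at hs
      obtain ⟨β, hβ, γ, hγ, rfl, ht⟩ := hs
      have h1 := h.pos β hβ
      have h2 := h.pos γ hγ
      obtain ⟨m, hm, hm1, hm2⟩ := ih (t β).toNat (by omega) β hβ rfl
      obtain ⟨m', hm', hm1', hm2'⟩ := ih (t γ).toNat (by omega) γ hγ rfl
      refine ⟨m + m', ?_, by simp [hm1, hm1'], by simp [hm2, hm2', ht]⟩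
      intro s hs
      rcases Multiset.mem_add.1 hs with h | h
      exacts [hm s h, hm' s h]

theorem inner_cases (h : HeightedRoots R t H) {α s : E} (hα : α ∈ R) (hs : s ∈ R) :
    α = s ∨ α = -s ∨ (α ≠ s ∧ α ≠ -s ∧ (⟪α, s⟫ = 0 ∨ ⟪α, s⟫ = 1 ∨ ⟪α, s⟫ = -1)) := by
  by_cases h1 : α = s
  · exact Or.inl h1
  by_cases h2 : α = -s
  · exact Or.inr (Or.inl h2)
  refine Or.inr (Or.inr ⟨h1, h2, ?_⟩)
  obtain ⟨n, hn⟩ := h.integral α hα s hs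
  have e1 : 0 < ⟪α - s, α - s⟫ := real_inner_self_pos.2 (sub_ne_zero.2 h1)
  have e2 : 0 < ⟪α + s, α + s⟫ := real_inner_self_pos.2 (fun h => h2 (eq_neg_of_add_eq_zero_left h))
  rw [inner_sub_sub_self, h.norm_two α hα, h.norm_two s hs, real_inner_comm α s, hn] at e1
  rw [inner_add_add_self, h.norm_two α hα, h.norm_two s hs, real_inner_comm α s, hn] at e2
  have a1 : (n : ℝ) < 2 := by linarith
  have a2 : (-2 : ℝ) < n := by linarith
  have a1 : n < 2 := by exact_mod_cast a1
  have a2 : -2 < n := by exact_mod_cast a2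
  rw [hn]
  have : n = 0 ∨ n = 1 ∨ n = -1 := by omega
  rcases this with rfl | rfl | rfl <;> simp

theorem inner_weighted_sum (h : HeightedRoots R t H) {C : ℝ}
    (hC : ∀ a : E, ∑ α ∈ R, ⟪α, a⟫ ^ 2 = C * ⟪a, a⟫) {s : E} (hs : IsSimple R t s) :
    ⟪∑ α ∈ R, (t α : ℝ) • α, s⟫ = C * t s - 2 * H := by
  classical
  have hsR := hs.1
  have hss := h.norm_two s hsR
  have hne : s ≠ -s := by
    intro he
    have : ⟪s, s⟫ = - ⟪s, s⟫ := by
      rw [← inner_neg_left, ← he]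
    linarith
  set R₁ := R.filter fun α => ⟪α, s⟫ = 1
  set R₂ := R.filter fun α => ⟪α, s⟫ = -1
  have hmap : R₂ = R₁.image (· - s) := by
    ext α
    simp only [R₁, R₂, Finset.mem_filter, Finset.mem_image]
    constructor
    · rintro ⟨hα, hi⟩
      refine ⟨α + s, ⟨?_, by rw [inner_add_left, hi, hss]; norm_num⟩, by simp⟩
      have := h.sub_mem α hα (-s) (h.neg_mem s hsR) (by rw [inner_neg_right, hi]; norm_num)
      simpa using this
    · rintro ⟨β, ⟨hβ, hi⟩, rfl⟩
      exact ⟨h.sub_mem β hβ s hsR hi, by rw [inner_sub_left, hi, hss]; norm_num⟩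
  have hinj : Set.InjOn (· - s) (R₁ : Set E) := sub_left_injective.injOn
  have hcard : R₂.card = R₁.card := by rw [hmap, Finset.card_image_of_injOn hinj]
  have hsum2 : ∑ α ∈ R₂, (t α : ℝ) = ∑ α ∈ R₁, (t (α - s) : ℝ) := by
    rw [hmap, Finset.sum_image hinj]
  have htt : ∀ α ∈ R₁, (t α : ℝ) = t (α - s) + t s := by
    intro α hα
    obtain ⟨hαR, hi⟩ := Finset.mem_filter.1 hα
    have hm := h.sub_mem α hαR s hsR hi
    have ha := h.add _ hm s hsR (by simpa using hαR)
    rw [sub_add_cancel] at ha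
    have b1 := h.pos _ hm
    have b2 := h.lt _ hm
    have b3 := h.pos _ hαR
    have b4 := h.lt _ hαR
    have b5 := h.pos _ hsR
    have b6 := h.lt _ hsR
    have hsim := hs.2 α hαR (s - α) (by simpa using h.neg_mem _ hm) (by simp)
    have hn := h.neg _ hm
    rw [neg_sub] at hn
    obtain ⟨k, hk⟩ := ha
    have hk1 : k < 1 := by
      by_contra! hc
      nlinarith
    have hk2 : -2 < k := by
      by_contra! hc
      nlinarith
    have : k = 0 ∨ k = -1 := by omega
    rcases this with rfl | rfl
    · have : t α = t (α - s) + t s := by linarith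
      exact_mod_cast this
    · exact absurd (by linarith) hsim
  have hpt : ∀ α ∈ R, ⟪α, s⟫ = 2 * (if α = s then 1 else 0) - 2 * (if α = -s then 1 else 0)
      + (if ⟪α, s⟫ = 1 then 1 else 0) - (if ⟪α, s⟫ = -1 then 1 else 0) := by
    intro α hα
    rcases h.inner_cases hα hsR with h1 | h1 | ⟨h1, h2, h3 | h3 | h3⟩
    · have h2 : ⟪α, s⟫ = 2 := by rw [h1, hss]
      rw [h2, if_pos h1, if_neg (h1 ▸ hne)]; norm_num
    · have h2 : ⟪α, s⟫ = -2 := by rw [h1, inner_neg_left, hss]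
      rw [h2, if_pos h1, if_neg (h1 ▸ hne.symm)]; norm_num
    all_goals simp [h1, h2, h3]; try norm_num
  have hpt2 : ∀ α ∈ R, ⟪α, s⟫ ^ 2 = 4 * (if α = s then 1 else 0) + 4 * (if α = -s then 1 else 0)
      + (if ⟪α, s⟫ = 1 then 1 else 0) + (if ⟪α, s⟫ = -1 then 1 else 0) := by
    intro α hα
    rcases h.inner_cases hα hsR with h1 | h1 | ⟨h1, h2, h3 | h3 | h3⟩
    · have h2 : ⟪α, s⟫ = 2 := by rw [h1, hss]
      rw [h2, if_pos h1, if_neg (h1 ▸ hne)]; norm_num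
    · have h2 : ⟪α, s⟫ = -2 := by rw [h1, inner_neg_left, hss]
      rw [h2, if_pos h1, if_neg (h1 ▸ hne.symm)]; norm_num
    all_goals simp [h1, h2, h3]; try norm_num
  have hCs := hC s
  rw [Finset.sum_congr rfl hpt2, hss] at hCs
  simp only [Finset.sum_add_distrib, ← Finset.mul_sum, Finset.sum_ite_eq', hsR, h.neg_mem s hsR,
    if_true, Finset.sum_boole] at hCs
  change _ + (R₁.card : ℝ) + (R₂.card : ℝ) = _ at hCs
  rw [hcard] at hCs
  rw [sum_inner]
  have : ∀ α ∈ R, ⟪(t α : ℝ) • α, s⟫ = 2 * (if α = s then (t α : ℝ) else 0)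
      - 2 * (if α = -s then (t α : ℝ) else 0)
      + (if ⟪α, s⟫ = 1 then (t α : ℝ) else 0) - (if ⟪α, s⟫ = -1 then (t α : ℝ) else 0) := by
    intro α hα
    rw [real_inner_smul_left]
    conv_lhs => rw [hpt α hα]
    simp only [mul_sub, mul_add, mul_ite, mul_one, mul_zero, mul_comm (t α : ℝ) 2]
  rw [Finset.sum_congr rfl this]
  simp only [Finset.sum_add_distrib, Finset.sum_sub_distrib, ← Finset.mul_sum, Finset.sum_ite_eq',
    hsR, h.neg_mem s hsR, if_true, ← Finset.sum_filter]
  change _ + ∑ α ∈ R₁, (t α : ℝ) - ∑ α ∈ R₂, (t α : ℝ) = _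
  rw [hsum2, Finset.sum_congr rfl htt, Finset.sum_add_distrib, h.neg s hsR]
  simp only [Finset.sum_const, nsmul_eq_mul]
  push_cast
  have : (R₁.card : ℝ) = C - 4 := by linarith
  rw [this]; ring

theorem mem_closure (h : HeightedRoots R t H) {C : ℝ}
    (hC : ∀ a : E, ∑ α ∈ R, ⟪α, a⟫ ^ 2 = C * ⟪a, a⟫)
    {I : Type*} [Fintype I] (b : I → ℝ) (ρ : I → E) (hb : 0 < ∑ i, b i)
    (hρ : ∀ i, b i ≠ 0 → ρ i ∈ R ∧ t (ρ i) = 1) (hz : ∑ i, b i • ρ i = 0) {α : E} (hα : α ∈ R) :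
    α ∈ AddSubmonoid.closure {ρ | ρ ∈ R ∧ t ρ = 1} := by
  set P := ∑ α ∈ R, (t α : ℝ) • α
  have hC2 : C = 2 * H := by
    have h0 : ⟪P, ∑ i, b i • ρ i⟫ = 0 := by rw [hz, inner_zero_right]
    rw [inner_sum] at h0
    have : ∀ i ∈ Finset.univ, ⟪P, b i • ρ i⟫ = b i * (C - 2 * H) := by
      intro i _
      rw [real_inner_smul_right]
      by_cases hi : b i = 0
      · simp [hi]
      obtain ⟨h1, h2⟩ := hρ i hi
      rw [h.inner_weighted_sum hC ⟨h1, ?_⟩, h2]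
      · push_cast; ring
      · intro β hβ γ hγ _
        have := h.pos β hβ
        have := h.pos γ hγ
        omega
    rw [Finset.sum_congr rfl this, ← Finset.sum_mul] at h0
    rcases mul_eq_zero.1 h0 with h1 | h1 <;> linarith
  have hH : 0 < H := (h.pos α hα).trans (h.lt α hα)
  obtain ⟨m, hm, hm1, hm2⟩ := h.exists_multiset α hα
  obtain ⟨m', hm', hm1', hm2'⟩ := h.exists_multiset (-α) (h.neg_mem α hα)
  have hmm : ∀ s ∈ m + m', IsSimple R t s := by
    intro s hs
    rcases Multiset.mem_add.1 hs with h | h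
    exacts [hm s h, hm' s h]
  have key : ∀ k : Multiset E, (∀ s ∈ k, IsSimple R t s) →
      ⟪P, k.sum⟫ = 2 * H * (((k.map fun s => t s - 1).sum : ℤ) : ℝ) := by
    intro k
    induction k using Multiset.induction_on with
    | empty => simp
    | cons s k ih =>
      intro hk
      rw [Multiset.sum_cons, inner_add_right, ih fun s hs => hk s (Multiset.mem_cons_of_mem hs),
        h.inner_weighted_sum hC (hk s (Multiset.mem_cons_self s k)), hC2]
      simp only [Multiset.map_cons, Multiset.sum_cons]
      push_cast; ring
  have h0 := key _ hmm
  rw [Multiset.sum_add, hm1, hm1', add_neg_cancel, inner_zero_right] at h0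
  have hHr : (0 : ℝ) < H := by exact_mod_cast hH
  have h1 : ((m + m').map fun s => t s - 1).sum = 0 := by
    rcases mul_eq_zero.1 h0.symm with h | h
    · linarith
    · exact_mod_cast h
  have h2 : ∀ s ∈ m, t s = 1 := by
    intro s hs
    have hall : ∀ x ∈ (m + m').map fun s => t s - 1, 0 ≤ x := by
      intro x hx
      obtain ⟨u, hu, rfl⟩ := Multiset.mem_map.1 hx
      have := h.pos u (hmm u hu).1
      omega
    have := Multiset.all_zero_of_le_zero_le_of_sum_eq_zero hall h1 (t s - 1)
      (Multiset.mem_map_of_mem (fun s => t s - 1) (Multiset.mem_add.2 (Or.inl hs)))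
    omega
  rw [← hm1]
  exact AddSubmonoid.multiset_sum_mem _ _ fun s hs =>
    AddSubmonoid.subset_closure ⟨(hm s hs).1, h2 s hs⟩

end HeightedRoots

/-- Full even unimodular lattices in a real inner product space. -/
structure EvenUnimodular {E : Type*} [NormedAddCommGroup E] [InnerProductSpace ℝ E]
    (M : Submodule ℤ E) : Prop where
  span_eq_top : Submodule.span ℝ (M : Set E) = ⊤
  even : ∀ x ∈ M, ∃ n : ℤ, ⟪x, x⟫ = 2 * n
  mem_of_integral : ∀ v : E, (∀ y ∈ M, ∃ n : ℤ, ⟪v, y⟫ = n) → v ∈ M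

namespace EvenUnimodular

variable {E : Type*} [NormedAddCommGroup E] [InnerProductSpace ℝ E] {M : Submodule ℤ E}

theorem integral (hM : EvenUnimodular M) {x y : E} (hx : x ∈ M) (hy : y ∈ M) :
    ∃ n : ℤ, ⟪x, y⟫ = n := by
  obtain ⟨a, ha⟩ := hM.even x hx
  obtain ⟨b, hb⟩ := hM.even y hy
  obtain ⟨c, hc⟩ := hM.even _ (M.add_mem hx hy)
  refine ⟨c - a - b, ?_⟩
  rw [inner_add_add_self, ha, hb, real_inner_comm x y] at hc
  push_cast
  linarith

/-- The lattice `{μ - a x : μ ∈ M, a ∈ ℤ, ⟪μ, x⟫ - a ⟪x, x⟫ / 2 ∈ ℤ}`. -/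
def neighbor (M : Submodule ℤ E) (x : E) : Submodule ℤ E where
  carrier := {y | ∃ μ ∈ M, ∃ a : ℤ, y = μ - (a : ℝ) • x ∧ ∃ n : ℤ, ⟪μ, x⟫ - a * ⟪x, x⟫ / 2 = n}
  add_mem' := by
    rintro _ _ ⟨μ, hμ, a, rfl, n, hn⟩ ⟨μ', hμ', a', rfl, n', hn'⟩
    refine ⟨μ + μ', M.add_mem hμ hμ', a + a', ?_, n + n', ?_⟩
    · push_cast; module
    · rw [inner_add_left]; push_cast; linarith
  zero_mem' := ⟨0, M.zero_mem, 0, by simp, 0, by simp⟩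
  smul_mem' := by
    rintro c _ ⟨μ, hμ, a, rfl, n, hn⟩
    refine ⟨c • μ, M.smul_mem c hμ, c * a, ?_, c * n, ?_⟩
    · rw [smul_sub, ← Int.cast_smul_eq_zsmul ℝ, ← Int.cast_smul_eq_zsmul ℝ]; push_cast; module
    · rw [← Int.cast_smul_eq_zsmul ℝ, real_inner_smul_left]
      push_cast
      rw [← hn]; ring

theorem exists_pairing_eq_one (hM : EvenUnimodular M) {x : E} {H₀ κ₀ : ℤ} (hH₀ : 0 < H₀)
    (hx₀ : (H₀ : ℝ) • x ∈ M) (hκ₀ : H₀ * ⟪x, x⟫ = 2 * κ₀) :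
    ∃ H κ : ℤ, 0 < H ∧ (H : ℝ) • x ∈ M ∧ H * ⟪x, x⟫ = 2 * κ ∧ ∃ μ ∈ M, ∃ a b : ℤ,
      H * ⟪x, μ⟫ - a * κ - b * H = 1 := by
  let S : AddSubgroup ℤ :=
    { carrier := {n | ∃ μ ∈ M, ∃ a b : ℤ, H₀ * ⟪x, μ⟫ - a * κ₀ - b * H₀ = n}
      add_mem' := by
        rintro m n ⟨μ, hμ, a, b, h⟩ ⟨μ', hμ', a', b', h'⟩
        refine ⟨μ + μ', M.add_mem hμ hμ', a + a', b + b', ?_⟩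
        push_cast; rw [inner_add_right, ← h, ← h']; ring
      zero_mem' := ⟨0, M.zero_mem, 0, 0, by simp⟩
      neg_mem' := by
        rintro m ⟨μ, hμ, a, b, h⟩
        refine ⟨-μ, M.neg_mem hμ, -a, -b, ?_⟩
        push_cast; rw [inner_neg_right, ← h]; ring }
  obtain ⟨k, hk⟩ := Int.subgroup_cyclic S
  have hmem : ∀ n, n ∈ S ↔ k ∣ n := by
    intro n
    rw [hk, ← AddSubgroup.zmultiples_eq_closure, Int.mem_zmultiples_iff]
  obtain ⟨H', hH'⟩ : k ∣ H₀ := (hmem _).1 ⟨0, M.zero_mem, 0, -1, by simp⟩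
  obtain ⟨κ', hκ'⟩ : k ∣ κ₀ := (hmem _).1 ⟨0, M.zero_mem, -1, 0, by simp⟩
  have hk0 : k ≠ 0 := by rintro rfl; simp at hH'; omega
  have hkr : (k : ℝ) ≠ 0 := by exact_mod_cast hk0
  have hHr : (H₀ : ℝ) = k * H' := by exact_mod_cast hH'
  have hκr : (κ₀ : ℝ) = k * κ' := by exact_mod_cast hκ'
  have h1 : (H' : ℝ) • x ∈ M := by
    apply hM.mem_of_integral
    intro μ hμ
    obtain ⟨n, hn⟩ := hM.integral hx₀ hμ
    rw [real_inner_smul_left] at hn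
    obtain ⟨m, rfl⟩ : k ∣ n := (hmem n).1 ⟨μ, hμ, 0, 0, by simp [hn]⟩
    refine ⟨m, ?_⟩
    rw [real_inner_smul_left]
    apply mul_left_cancel₀ hkr
    rw [← mul_assoc, ← hHr, hn]; push_cast; ring
  have h2 : H' * ⟪x, x⟫ = 2 * κ' := by
    apply mul_left_cancel₀ hkr
    rw [← mul_assoc, ← hHr, hκ₀, hκr]; ring
  obtain ⟨μ, hμ, a, b, hab⟩ : k ∈ S := (hmem k).2 dvd_rfl
  have h3 : H' * ⟪x, μ⟫ - a * κ' - b * H' = 1 := by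
    apply mul_left_cancel₀ hkr
    rw [hHr, hκr] at hab
    linear_combination hab
  have hH0 : H' ≠ 0 := by rintro rfl; simp at hH'; omega
  rcases lt_or_gt_of_ne hH0 with h | h
  · refine ⟨-H', -κ', by omega, ?_, ?_, -μ, M.neg_mem hμ, -a, -b, ?_⟩
    · have := M.neg_mem h1
      rw [← neg_smul] at this
      exact_mod_cast this
    · push_cast; linarith
    · push_cast; rw [inner_neg_right]; linarith
  · exact ⟨H', κ', h, h1, h2, μ, hμ, a, b, h3⟩

theorem neighbor_evenUnimodular (hM : EvenUnimodular M) {x : E} {H κ : ℤ} (hH : 0 < H)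
    (hx : (H : ℝ) • x ∈ M) (hκ : H * ⟪x, x⟫ = 2 * κ) {μ₀ : E} (hμ₀ : μ₀ ∈ M) {a₀ b₀ : ℤ}
    (he : H * ⟪x, μ₀⟫ - a₀ * κ - b₀ * H = 1) : EvenUnimodular (neighbor M x) := by
  have hHr : (0 : ℝ) < H := by exact_mod_cast hH
  refine ⟨?_, ?_, ?_⟩
  · rw [eq_top_iff, ← hM.span_eq_top, Submodule.span_le]
    intro μ hμ
    have : (H : ℝ) • μ ∈ neighbor M x := by
      obtain ⟨n, hn⟩ := hM.integral hx hμ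
      refine ⟨(H : ℝ) • μ, ?_, 0, by simp, n, ?_⟩
      · rw [Int.cast_smul_eq_zsmul]; exact M.smul_mem _ hμ
      · rw [real_inner_smul_left] at *
        rw [real_inner_comm, hn]; simp
    have := Submodule.smul_mem (Submodule.span ℝ (neighbor M x : Set E)) (H : ℝ)⁻¹
      (Submodule.subset_span this)
    rwa [smul_smul, inv_mul_cancel₀ hHr.ne', one_smul] at this
  · rintro _ ⟨μ, hμ, a, rfl, n, hn⟩
    obtain ⟨m, hm⟩ := hM.even μ hμ
    refine ⟨m - a * n, ?_⟩
    rw [inner_sub_sub_self, hm]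
    simp only [real_inner_smul_left, real_inner_smul_right]
    rw [real_inner_comm μ x]
    push_cast
    rw [← hn]; ring
  · intro y hy
    set θ : ℝ := ⟪y, μ₀⟫ - a₀ * ⟪x, y⟫ with hθ
    have key : ∀ μ ∈ M, ∀ a b p : ℤ, H * ⟪x, μ⟫ - a * κ - b * H = p →
        ∃ n : ℤ, ⟪y, μ⟫ - a * ⟪x, y⟫ - p * θ = n := by
      intro μ hμ a b p hp
      have : (μ - p • μ₀) - ((a - p * a₀ : ℤ) : ℝ) • x ∈ neighbor M x := by
        refine ⟨μ - p • μ₀, M.sub_mem hμ (M.smul_mem p hμ₀), a - p * a₀, rfl, b - p * b₀, ?_⟩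
        apply mul_left_cancel₀ hHr.ne'
        rw [← Int.cast_smul_eq_zsmul ℝ, inner_sub_left, real_inner_smul_left,
          real_inner_comm x μ, real_inner_comm x μ₀]
        push_cast
        have e1 : (H : ℝ) * (⟪x, μ⟫ - p * ⟪x, μ₀⟫ - (a - p * a₀) * ⟪x, x⟫ / 2)
          = H * ⟪x, μ⟫ - p * (H * ⟪x, μ₀⟫) - (a - p * a₀) * (H * ⟪x, x⟫) / 2 := by ring
        rw [e1, hκ]
        linear_combination hp - p * he
      obtain ⟨n, hn⟩ := hy _ this
      refine ⟨n, ?_⟩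
      rw [← hn, ← Int.cast_smul_eq_zsmul ℝ, inner_sub_right, inner_sub_right,
        real_inner_smul_right, real_inner_smul_right, hθ, real_inner_comm x y]
      push_cast; ring
    obtain ⟨a, ha⟩ := key 0 M.zero_mem 0 1 (-H) (by simp)
    obtain ⟨b, hb⟩ := key 0 M.zero_mem 1 0 (-κ) (by simp)
    have hmem : y - θ • (H : ℝ) • x ∈ M := by
      apply hM.mem_of_integral
      intro μ hμ
      obtain ⟨p, hp⟩ := hM.integral hx hμ
      rw [real_inner_smul_left] at hp
      obtain ⟨n, hn⟩ := key μ hμ 0 0 p (by simp [hp])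
      refine ⟨n, ?_⟩
      rw [← hn, inner_sub_left, real_inner_smul_left, real_inner_smul_left, hp]
      push_cast; ring
    refine ⟨_, hmem, -a, ?_, -b, ?_⟩
    · simp at ha
      push_cast
      rw [← ha]; module
    · simp at ha hb
      push_cast
      rw [← ha, ← hb, inner_sub_left, real_inner_smul_left, real_inner_smul_left,
        real_inner_comm x y]
      linear_combination (-θ / 2) * hκ

theorem dvd_of_sub_smul_eq (hM : EvenUnimodular M) {x : E} {H κ : ℤ}
    (hκ : H * ⟪x, x⟫ = 2 * κ) {μ₀ : E} (hμ₀ : μ₀ ∈ M) {a₀ b₀ : ℤ}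
    (he : H * ⟪x, μ₀⟫ - a₀ * κ - b₀ * H = 1) {μ μ' : E} (hμ : μ ∈ M) (hμ' : μ' ∈ M) {a a' n n' : ℤ}
    (h : μ - (a : ℝ) • x = μ' - (a' : ℝ) • x) (hn : ⟪μ, x⟫ - a * ⟪x, x⟫ / 2 = n)
    (hn' : ⟪μ', x⟫ - a' * ⟪x, x⟫ / 2 = n') : H ∣ a - a' := by
  have hd : ((a : ℝ) - a') • x = μ - μ' := by
    have : ((a : ℝ) - a') • x = μ - (μ - (a : ℝ) • x) - (a' : ℝ) • x := by module
    rw [this, h]; module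
  obtain ⟨p, hp⟩ := hM.integral (M.sub_mem hμ hμ') hμ₀
  have h1 : ((a : ℝ) - a') * ⟪x, x⟫ = ⟪μ, x⟫ - ⟪μ', x⟫ := by
    rw [← inner_sub_left, ← hd, real_inner_smul_left]
  rw [← hd, real_inner_smul_left] at hp
  refine ⟨p - (a - a') * b₀ - a₀ * (n - n'), ?_⟩
  have : ((a : ℝ) - a') = H * (p - (a - a') * b₀ - a₀ * (n - n')) := by
    rw [← hp, ← hn, ← hn']
    linear_combination (-(a:ℝ) + a') * he + (a - a') * a₀ / 2 * hκ - a₀ * H * h1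
  exact_mod_cast this

/-- The neighbor construction together with its height function. -/
theorem exists_neighbor (hM : EvenUnimodular M) {x : E} {H₀ κ₀ : ℤ} (hH₀ : 0 < H₀)
    (hx₀ : (H₀ : ℝ) • x ∈ M) (hκ₀ : H₀ * ⟪x, x⟫ = 2 * κ₀) :
    ∃ (N : Submodule ℤ E) (H : ℤ) (t : E → ℤ), EvenUnimodular N ∧ (∀ y, 0 ≤ t y) ∧
      (∀ y, t y < H) ∧ (∀ y ∈ N, y + (t y : ℝ) • x ∈ M) ∧
      (∀ μ ∈ M, ⟪μ - x, μ - x⟫ = 2 → μ - x ∈ N ∧ t (μ - x) = 1 % H) ∧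
      (∀ y ∈ N, ∀ z ∈ N, H ∣ t (y + z) - (t y + t z)) := by
  classical
  obtain ⟨H, κ, hH, hx, hκ, μ₀, hμ₀, a₀, b₀, he⟩ := hM.exists_pairing_eq_one hH₀ hx₀ hκ₀
  let t : E → ℤ := fun y => if h : y ∈ neighbor M x then h.choose_spec.2.choose % H else 0
  have ht : ∀ μ ∈ M, ∀ a n : ℤ, ⟪μ, x⟫ - a * ⟪x, x⟫ / 2 = n → t (μ - (a : ℝ) • x) = a % H := by
    intro μ hμ a n hn
    have hmem : μ - (a : ℝ) • x ∈ neighbor M x := ⟨μ, hμ, a, rfl, n, hn⟩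
    simp only [t, dif_pos hmem]
    obtain ⟨h1, m, hm⟩ := hmem.choose_spec.2.choose_spec
    exact (Int.modEq_iff_dvd.2 (hM.dvd_of_sub_smul_eq hκ hμ₀ he hmem.choose_spec.1 hμ
      h1.symm hm hn)).symm
  refine ⟨neighbor M x, H, t, hM.neighbor_evenUnimodular hH hx hκ hμ₀ he, ?_, ?_, ?_, ?_, ?_⟩
  · intro y
    by_cases h : y ∈ neighbor M x
    · simp only [t, dif_pos h]; exact Int.emod_nonneg _ hH.ne'
    · simp only [t, dif_neg h]; rfl
  · intro y
    by_cases h : y ∈ neighbor M x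
    · simp only [t, dif_pos h]; exact Int.emod_lt_of_pos _ hH
    · simpa only [t, dif_neg h]
  · rintro _ ⟨μ, hμ, a, rfl, n, hn⟩
    rw [ht μ hμ a n hn, Int.emod_def]
    have : μ - (a : ℝ) • x + ((a - H * (a / H) : ℤ) : ℝ) • x = μ - (a / H : ℤ) • (H : ℝ) • x := by
      rw [← Int.cast_smul_eq_zsmul ℝ]; push_cast; module
    rw [this]
    exact M.sub_mem hμ (M.smul_mem _ hx)
  · intro μ hμ h2
    obtain ⟨m, hm⟩ := hM.even μ hμ
    have hn : ⟪μ, x⟫ - (1 : ℤ) * ⟪x, x⟫ / 2 = (m - 1 : ℤ) := by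
      rw [inner_sub_sub_self, hm, real_inner_comm μ x] at h2
      push_cast; linarith
    have e : μ - x = μ - ((1 : ℤ) : ℝ) • x := by simp
    rw [e]
    exact ⟨⟨μ, hμ, 1, rfl, _, hn⟩, ht μ hμ 1 _ hn⟩
  · rintro _ ⟨μ, hμ, a, rfl, n, hn⟩ _ ⟨μ', hμ', a', rfl, n', hn'⟩
    have e : μ - (a : ℝ) • x + (μ' - (a' : ℝ) • x) = (μ + μ') - ((a + a' : ℤ) : ℝ) • x := by
      push_cast; module
    rw [e, ht μ hμ a n hn, ht μ' hμ' a' n' hn', ht _ (M.add_mem hμ hμ') (a + a') (n + n') (by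
      rw [inner_add_left]; push_cast; linarith)]
    apply Int.ModEq.dvd
    exact ((Int.mod_modEq a H).add (Int.mod_modEq a' H)).trans (Int.mod_modEq _ H).symm

end EvenUnimodular

theorem ZLattice.finite_inter_closedBall {E : Type*} [NormedAddCommGroup E] [ProperSpace E]
    (M : Submodule ℤ E) [DiscreteTopology M] (c : E) (r : ℝ) :
    ((M : Set E) ∩ Metric.closedBall c r).Finite := by
  have H : IsClosed (M : Set E) :=
    @AddSubgroup.isClosed_of_discrete _ _ _ _ _ M.toAddSubgroup
      (inferInstanceAs (DiscreteTopology M))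
  rw [Set.inter_comm]
  exact Metric.finite_isBounded_inter_isClosed DiscreteTopology.isDiscrete
    Metric.isBounded_closedBall H

/-- A point at maximal distance from a lattice lies in the convex hull of the lattice points
nearest to it. -/
theorem ZLattice.exists_deep_hole {E : Type*} [NormedAddCommGroup E] [InnerProductSpace ℝ E]
    [FiniteDimensional ℝ E] (M : Submodule ℤ E) [DiscreteTopology M] [IsZLattice ℝ M] :
    ∃ (c : E) (r : ℝ) (s : Finset E), (∀ l ∈ M, r ≤ ‖c - l‖) ∧ (∀ x, ∃ l ∈ M, ‖x - l‖ ≤ r) ∧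
      (∀ l ∈ s, l ∈ M ∧ ‖c - l‖ = r) ∧ c ∈ convexHull ℝ (s : Set E) := by
  have hcl : IsClosed (M : Set E) :=
    @AddSubgroup.isClosed_of_discrete _ _ _ _ _ M.toAddSubgroup
      (inferInstanceAs (DiscreteTopology M))
  have hne : (M : Set E).Nonempty := ⟨0, M.zero_mem⟩
  have hper : ∀ z w, w ∈ M → Metric.infDist (z + w) (M : Set E) = Metric.infDist z (M : Set E) := by
    have hle : ∀ z w, w ∈ M → Metric.infDist (z + w) (M : Set E) ≤ Metric.infDist z (M : Set E) := by
      intro z w hw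
      obtain ⟨y, hy, hd⟩ := hcl.exists_infDist_eq_dist hne z
      rw [hd, ← dist_add_right z y w]
      exact Metric.infDist_le_dist_of_mem (M.add_mem hy hw)
    intro z w hw
    refine le_antisymm (hle z w hw) ?_
    simpa using hle (z + w) (-w) (M.neg_mem hw)
  obtain ⟨_, ⟨c, rfl⟩, hc⟩ := (IsZLattice.isCompact_range_of_periodic M _
    (Metric.continuous_infDist_pt (M : Set E)) hper).exists_isGreatest (Set.range_nonempty _)
  set r := Metric.infDist c (M : Set E) with hr
  have hfin := ZLattice.finite_inter_closedBall M c (r + 1)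
  have hlow : ∀ l ∈ M, r ≤ ‖c - l‖ := fun l hl => by
    rw [← dist_eq_norm]; exact Metric.infDist_le_dist_of_mem hl
  set s : Finset E := hfin.toFinset.filter fun l => ‖c - l‖ = r with hs
  have hsmem : ∀ l, l ∈ s ↔ l ∈ M ∧ ‖c - l‖ = r := by
    intro l
    simp only [hs, Finset.mem_filter, Set.Finite.mem_toFinset, Set.mem_inter_iff, SetLike.mem_coe,
      Metric.mem_closedBall, dist_comm l c, dist_eq_norm]
    constructor
    · rintro ⟨⟨h1, -⟩, h2⟩; exact ⟨h1, h2⟩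
    · rintro ⟨h1, h2⟩; exact ⟨⟨h1, by linarith⟩, h2⟩
  refine ⟨c, r, s, hlow, ?_, fun l hl => (hsmem l).1 hl, ?_⟩
  · intro x
    obtain ⟨y, hy, hd⟩ := hcl.exists_infDist_eq_dist hne x
    refine ⟨y, hy, ?_⟩
    rw [← dist_eq_norm, ← hd]
    exact hc ⟨x, rfl⟩
  · by_contra hcon
    obtain ⟨f, u, hfc, hfu⟩ := geometric_hahn_banach_point_closed (convex_convexHull ℝ (s : Set E))
      (s.finite_toSet.isCompact_convexHull ℝ).isClosed hcon
    set w := (InnerProductSpace.toDual ℝ E).symm f with hw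
    have hwf : ∀ x, ⟪w, x⟫ = f x := fun x => InnerProductSpace.toDual_symm_apply
    have hwpos : ∀ l ∈ s, 0 < ⟪c - l, -w⟫ := by
      intro l hl
      rw [inner_neg_right, real_inner_comm, inner_sub_right, hwf, hwf]
      have := hfu l (subset_convexHull ℝ _ hl)
      linarith
    have hev : ∀ l ∈ hfin.toFinset, ∀ᶠ ε in nhdsWithin (0 : ℝ) (Set.Ioi 0), r < ‖c - ε • w - l‖ := by
      intro l hl
      have hlM : l ∈ M := by simpa using ((hfin.mem_toFinset).1 hl).1
      by_cases hls : l ∈ s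
      · filter_upwards [self_mem_nhdsWithin] with ε hε
        have h0 : 0 ≤ r := Metric.infDist_nonneg
        apply lt_of_pow_lt_pow_left₀ 2 (norm_nonneg _)
        have e : c - ε • w - l = (c - l) + ε • (-w) := by module
        rw [e, norm_add_sq_real, ((hsmem l).1 hls).2, real_inner_smul_right]
        have := mul_pos (Set.mem_Ioi.1 hε) (hwpos l hls)
        have := sq_nonneg ‖ε • (-w)‖
        linarith
      · have h1 : r < ‖c - l‖ := lt_of_le_of_ne (hlow l hlM) fun h => hls ((hsmem l).2 ⟨hlM, h.symm⟩)
        have hcont : Continuous fun ε : ℝ => ‖c - ε • w - l‖ := by fun_prop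
        have h2 : r < ‖c - (0 : ℝ) • w - l‖ := by simpa using h1
        exact ((hcont.tendsto 0).eventually (lt_mem_nhds h2)).filter_mono nhdsWithin_le_nhds
    have hev2 : ∀ᶠ ε in nhdsWithin (0 : ℝ) (Set.Ioi 0), ‖ε • w‖ < 1 := by
      have hcont : Continuous fun ε : ℝ => ‖ε • w‖ := by fun_prop
      have h2 : ‖(0 : ℝ) • w‖ < 1 := by simp
      exact ((hcont.tendsto 0).eventually (gt_mem_nhds h2)).filter_mono nhdsWithin_le_nhds
    obtain ⟨ε, h1, h2⟩ := (((Finset.eventually_all _).2 hev).and hev2).exists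
    obtain ⟨y, hy, hd⟩ := hcl.exists_infDist_eq_dist hne (c - ε • w)
    have hle : Metric.infDist (c - ε • w) (M : Set E) ≤ r := hc ⟨_, rfl⟩
    rw [hd, dist_eq_norm] at hle
    by_cases hyF : y ∈ hfin.toFinset
    · exact absurd (h1 y hyF) (not_lt.2 hle)
    · apply hyF
      rw [Set.Finite.mem_toFinset]
      refine ⟨hy, ?_⟩
      rw [Metric.mem_closedBall, dist_comm, dist_eq_norm]
      calc ‖c - y‖ = ‖(c - ε • w - y) + ε • w‖ := by congr 1; module
        _ ≤ _ := norm_add_le _ _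
        _ ≤ r + 1 := by linarith

namespace EvenUnimodular

variable {E : Type*} [NormedAddCommGroup E] [InnerProductSpace ℝ E]

theorem discreteTopology {M : Submodule ℤ E} (hM : EvenUnimodular M) : DiscreteTopology M := by
  refine DiscreteTopology.of_forall_le_norm (r := 1) one_pos ?_
  intro x hx
  obtain ⟨n, hn⟩ := hM.even x x.2
  have hpos : 0 < ⟪(x : E), (x : E)⟫ := real_inner_self_pos.2 (by simpa using hx)
  rw [real_inner_self_eq_norm_sq] at hn hpos
  rw [hn] at hpos
  have : 0 < n := by
    have : (0 : ℝ) < n := by linarith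
    exact_mod_cast this
  have : (1 : ℝ) ≤ n := by exact_mod_cast this
  change 1 ≤ ‖(x : E)‖
  nlinarith [norm_nonneg (x : E)]

theorem isZLattice {M : Submodule ℤ E} (hM : EvenUnimodular M) [DiscreteTopology M] :
    IsZLattice ℝ M := ⟨hM.span_eq_top⟩

end EvenUnimodular

open Filter Topology in
theorem exists_int_of_quadratic_neg {I : Type*} [Fintype I] (g : I → I → ℝ) (w : I → ℝ)
    (hw : ∀ i, 0 ≤ w i) (hneg : ∑ i, ∑ j, w i * g i j * w j < 0) :
    ∃ b : I → ℤ, 0 ≤ b ∧ b ≠ 0 ∧ ∑ i, ∑ j, (b i : ℝ) * g i j * b j < 0 := by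
  have hlim : ∀ i, Tendsto (fun n : ℝ => (⌊w i * n⌋₊ : ℝ) / n) atTop (𝓝 (w i)) :=
    fun i => tendsto_nat_floor_mul_div_atTop (hw i)
  have ht : Tendsto (fun n : ℝ => ∑ i, ∑ j, ((⌊w i * n⌋₊ : ℝ) / n) * g i j * ((⌊w j * n⌋₊ : ℝ) / n))
      atTop (𝓝 (∑ i, ∑ j, w i * g i j * w j)) :=
    tendsto_finsetSum _ fun i _ => tendsto_finsetSum _ fun j _ =>
      ((hlim i).mul_const _).mul (hlim j)
  obtain ⟨n, hn, hn0⟩ := ((ht.eventually (gt_mem_nhds hneg)).and (eventually_gt_atTop 0)).exists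
  have hq : ∑ i, ∑ j, (((⌊w i * n⌋₊ : ℕ) : ℤ) : ℝ) * g i j * ((⌊w j * n⌋₊ : ℕ) : ℤ) < 0 := by
    have e : ∑ i, ∑ j, (((⌊w i * n⌋₊ : ℕ) : ℤ) : ℝ) * g i j * ((⌊w j * n⌋₊ : ℕ) : ℤ) = n ^ 2 *
        ∑ i, ∑ j, ((⌊w i * n⌋₊ : ℝ) / n) * g i j * ((⌊w j * n⌋₊ : ℝ) / n) := by
      simp only [Finset.mul_sum]
      refine Finset.sum_congr rfl fun i _ => Finset.sum_congr rfl fun j _ => ?_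
      push_cast
      field_simp
    rw [e]
    exact mul_neg_of_pos_of_neg (by positivity) hn
  refine ⟨fun i => (⌊w i * n⌋₊ : ℕ), fun i => Int.natCast_nonneg _, ?_, hq⟩
  intro h
  have h' : ∀ i, ((⌊w i * n⌋₊ : ℕ) : ℤ) = 0 := fun i => congrFun h i
  simp [h'] at hq

/-- Weighted form of the parallel axis theorem. -/
theorem sum_mul_inner_sub_self {E : Type*} [NormedAddCommGroup E] [InnerProductSpace ℝ E]
    {I : Type*} [Fintype I] (b : I → ℝ) (p : I → E) (x y : E)
    (hx : ∑ i, b i • p i = (∑ i, b i) • x) :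
    ∑ i, b i * ⟪p i - y, p i - y⟫ =
      (∑ i, b i) * ⟪x - y, x - y⟫ + ∑ i, b i * ⟪p i - x, p i - x⟫ := by
  have h0 : ∑ i, b i * ⟪p i, y⟫ = (∑ i, b i) * ⟪x, y⟫ := by
    rw [← real_inner_smul_left, ← hx, sum_inner]; simp only [real_inner_smul_left]
  have h1 : ∑ i, b i * ⟪p i, x⟫ = (∑ i, b i) * ⟪x, x⟫ := by
    rw [← real_inner_smul_left, ← hx, sum_inner]; simp only [real_inner_smul_left]
  have h2 : ∀ z : E, ∑ i, b i * ⟪p i - z, p i - z⟫ = ∑ i, b i * ⟪p i, p i⟫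
      - 2 * ∑ i, b i * ⟪p i, z⟫ + (∑ i, b i) * ⟪z, z⟫ := by
    intro z
    rw [Finset.mul_sum, Finset.sum_mul, ← Finset.sum_sub_distrib, ← Finset.sum_add_distrib]
    refine Finset.sum_congr rfl fun i _ => ?_
    rw [inner_sub_sub_self, real_inner_comm (p i) z]; ring
  rw [h2, h2, h0, h1, inner_sub_sub_self, real_inner_comm x y]; ring

namespace EvenUnimodular

variable {E : Type*} [NormedAddCommGroup E] [InnerProductSpace ℝ E]

/-- The roots of a neighbor of a rootless lattice, together with their heights. -/
theorem heightedRoots {M N : Submodule ℤ E} (hN : EvenUnimodular N)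
    (hroots : ∀ x ∈ M, ⟪x, x⟫ ≠ 2) {x : E} {H : ℤ} {t : E → ℤ} (ht0 : ∀ y, 0 ≤ t y)
    (htH : ∀ y, t y < H) (htM : ∀ y ∈ N, y + (t y : ℝ) • x ∈ M)
    (hadd : ∀ y ∈ N, ∀ z ∈ N, H ∣ t (y + z) - (t y + t z)) {R : Finset E}
    (hR : ∀ y, y ∈ R ↔ y ∈ N ∧ ⟪y, y⟫ = 2) : HeightedRoots R t H := by
  have hpos : ∀ α ∈ R, 0 < t α := by
    intro α hα
    refine lt_of_le_of_ne (ht0 α) fun h => ?_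
    have := htM α ((hR α).1 hα).1
    rw [← h] at this
    simp only [Int.cast_zero, zero_smul, add_zero] at this
    exact hroots α this ((hR α).1 hα).2
  have hneg : ∀ α ∈ R, -α ∈ R := fun α hα => (hR _).2
    ⟨N.neg_mem ((hR α).1 hα).1, by rw [inner_neg_neg]; exact ((hR α).1 hα).2⟩
  have hz : t 0 = 0 := by
    have h := hadd 0 N.zero_mem 0 N.zero_mem
    rw [add_zero, sub_add_cancel_left, dvd_neg] at h
    exact Int.eq_zero_of_dvd_of_nonneg_of_lt (ht0 0) (htH 0) h
  refine ⟨fun α hα => ((hR α).1 hα).2, hneg, ?_, ?_, hpos, fun α _ => htH α, ?_, ?_⟩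
  · exact fun α hα β hβ => hN.integral ((hR α).1 hα).1 ((hR β).1 hβ).1
  · intro α hα β hβ h
    refine (hR _).2 ⟨N.sub_mem ((hR α).1 hα).1 ((hR β).1 hβ).1, ?_⟩
    rw [inner_sub_sub_self, real_inner_comm α β, h, ((hR α).1 hα).2, ((hR β).1 hβ).2]; norm_num
  · intro α hα
    have h := hadd α ((hR α).1 hα).1 (-α) ((hR _).1 (hneg α hα)).1
    rw [add_neg_cancel, hz, zero_sub, dvd_neg] at h
    obtain ⟨k, hk⟩ := h
    have h1 := hpos α hα
    have h2 := hpos _ (hneg α hα)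
    have h3 := htH α
    have h4 := htH (-α)
    have hk1 : 0 < k := by
      by_contra! hc
      nlinarith
    have hk2 : k < 2 := by
      by_contra! hc
      nlinarith
    obtain rfl : k = 1 := by omega
    linarith
  · exact fun α hα β hβ _ => hadd α ((hR α).1 hα).1 β ((hR β).1 hβ).1

/-- A rootless even unimodular lattice has covering radius at most `√2`, provided that its vectors
are congruent modulo 2 to vectors of norm at most 8 and that the roots of every even unimodular
lattice in the same space form a spherical 2-design. -/
theorem exists_inner_sub_le_two [FiniteDimensional ℝ E] {M : Submodule ℤ E}
    (hM : EvenUnimodular M) (hroots : ∀ x ∈ M, ⟪x, x⟫ ≠ 2)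
    (hshort : ∀ y ∈ M, ∃ κ ∈ M, ⟪y - (2 : ℝ) • κ, y - (2 : ℝ) • κ⟫ ≤ 8)
    (hdesign : ∀ N : Submodule ℤ E, EvenUnimodular N → ∀ R : Finset E,
      (∀ y, y ∈ R ↔ y ∈ N ∧ ⟪y, y⟫ = 2) → ∃ C : ℝ, ∀ a : E, ∑ α ∈ R, ⟪α, a⟫ ^ 2 = C * ⟪a, a⟫)
    (x : E) : ∃ l ∈ M, ⟪x - l, x - l⟫ ≤ 2 := by
  classical
  have := hM.discreteTopology
  have := hM.isZLattice
  obtain ⟨c, r, s, hlow, hup, hs, hc⟩ := ZLattice.exists_deep_hole M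
  by_contra! hcon
  have hr2 : 2 < r ^ 2 := by
    obtain ⟨l, hl, hlr⟩ := hup x
    have := hcon l hl
    rw [real_inner_self_eq_norm_sq] at this
    nlinarith [norm_nonneg (x - l)]
  have hr0 : 0 ≤ r := by
    obtain ⟨l, hl, hlr⟩ := hup x
    exact (norm_nonneg _).trans hlr
  have hlow2 : ∀ l ∈ M, r ^ 2 ≤ ⟪l - c, l - c⟫ := by
    intro l hl
    rw [real_inner_self_eq_norm_sq, norm_sub_rev]
    exact pow_le_pow_left₀ hr0 (hlow l hl) 2
  have hsr : ∀ i : s, ⟪(i : E) - c, (i : E) - c⟫ = r ^ 2 := by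
    intro i
    rw [real_inner_self_eq_norm_sq, norm_sub_rev, (hs i i.2).2]
  have hsM : ∀ i : s, (i : E) ∈ M := fun i => (hs i i.2).1
  obtain ⟨w, hw0, hw1, hwc⟩ := Finset.mem_convexHull'.1 hc
  choose m hm using fun i j : s => hM.even _ (M.sub_mem (hsM i) (hsM j))
  have hm8 : ∀ i j, m i j ≤ 4 := by
    intro i j
    obtain ⟨κ, hκ, h8⟩ := hshort _ (M.sub_mem (hsM i) (hsM j))
    have h1 := hlow2 _ (M.sub_mem (hsM i) hκ)
    have h2 := hlow2 _ (M.add_mem (hsM j) hκ)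
    have e : ⟪(i : E) - κ - c, (i : E) - κ - c⟫ + ⟪(j : E) + κ - c, (j : E) + κ - c⟫ =
        ⟪(i : E) - c, (i : E) - c⟫ + ⟪(j : E) - c, (j : E) - c⟫
        + (⟪(i : E) - j - (2 : ℝ) • κ, (i : E) - j - (2 : ℝ) • κ⟫
          - ⟪(i : E) - j, (i : E) - j⟫) / 2 := by
      have e1 : (i : E) - κ - c = ((i : E) - c) - κ := by abel
      have e2 : (j : E) + κ - c = ((j : E) - c) + κ := by abel
      have e3 : (i : E) - j = ((i : E) - c) - ((j : E) - c) := by abel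
      rw [e1, e2, e3]
      generalize (i : E) - c = u
      generalize (j : E) - c = v
      simp only [inner_sub_left, inner_sub_right, inner_add_left, inner_add_right,
        real_inner_smul_left, real_inner_smul_right]
      rw [real_inner_comm u κ, real_inner_comm v κ]
      ring
    rw [hsr, hsr, hm] at e
    have : (m i j : ℝ) ≤ 4 := by linarith
    exact_mod_cast this
  have hmsymm : ∀ i j, m i j = m j i := by
    intro i j
    have h1 := hm i j
    rw [← neg_sub, inner_neg_neg, hm j i] at h1
    have : (m i j : ℝ) = m j i := by linarith
    exact_mod_cast this
  have hmdiag : ∀ i, m i i = 0 := by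
    intro i
    have h1 := hm i i
    simp at h1
    exact h1
  obtain ⟨b₁, hb₁0, hb₁ne, hb₁neg⟩ := exists_int_of_quadratic_neg (fun i j : s => 2 - (m i j : ℝ))
    (fun i => w i) (fun i => hw0 i i.2) (by
      have hwc' : ∑ i : s, w i • (i : E) = (∑ i : s, w i) • c := by
        rw [Finset.sum_coe_sort s w, hw1, one_smul, Finset.sum_coe_sort s fun i => w i • i, hwc]
      have hw1' : ∑ i : s, w i = 1 := by rw [Finset.sum_coe_sort s w, hw1]
      have hj : ∀ j : s, ∑ i : s, w i * (2 - (m i j : ℝ)) * w j = (2 - r ^ 2) * w j := by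
        intro j
        have h := sum_mul_inner_sub_self (fun i : s => w i) (fun i : s => (i : E)) c j hwc'
        simp only [hsr, hm, ← Finset.sum_mul, hw1'] at h
        rw [← neg_sub, inner_neg_neg, hsr] at h
        rw [← Finset.sum_mul]
        congr 1
        simp only [mul_sub, Finset.sum_sub_distrib, ← Finset.sum_mul, hw1']
        have : ∑ i : s, w i * (2 * (m i j : ℝ)) = 2 * ∑ i : s, w i * (m i j : ℝ) := by
          rw [Finset.mul_sum]; exact Finset.sum_congr rfl fun i _ => by ring
        linarith
      rw [Finset.sum_comm, Finset.sum_congr rfl fun j _ => hj j, ← Finset.mul_sum, hw1']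
      linarith)
  have hf : ∀ u v : s → ℤ, Matrix.toBilin' (Matrix.of fun i j => 2 - m i j) u v =
      ∑ i, ∑ j, u i * (2 - m i j) * v j := fun u v => by
    rw [Matrix.toBilin'_apply]; rfl
  obtain ⟨b, hb0, hbne, -, hbr⟩ := exists_isotropic_of_nonpos
    (Matrix.toBilin' (Matrix.of fun i j => 2 - m i j)) (by
      intro u v
      rw [hf, hf, Finset.sum_comm]
      refine Finset.sum_congr rfl fun i _ => Finset.sum_congr rfl fun j _ => ?_
      rw [hmsymm]; ring)
    (by intro i; simp [hmdiag])
    (by intro i j; simp; linarith [hm8 i j])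
    ⟨b₁, hb₁0, hb₁ne, by
      rw [hf]
      exact_mod_cast hb₁neg.le⟩
  set H₀ : ℤ := ∑ i, b i with hH₀
  have hH₀pos : 0 < H₀ := by
    refine Finset.sum_pos' (fun i _ => hb0 i) ?_
    by_contra! h
    exact hbne (le_antisymm (fun i => h i (Finset.mem_univ i)) hb0)
  have hH₀r : (0 : ℝ) < H₀ := by exact_mod_cast hH₀pos
  have hH₀c : ∑ i, (b i : ℝ) = H₀ := by rw [hH₀]; push_cast; rfl
  set z : E := (H₀ : ℝ)⁻¹ • ∑ i, (b i : ℝ) • (i : E) with hz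
  have hzsum : ∑ i, (b i : ℝ) • (i : E) = (∑ i, (b i : ℝ)) • z := by
    rw [hH₀c, hz, smul_smul, mul_inv_cancel₀ hH₀r.ne', one_smul]
  have hzz : ∀ y : E, ∑ i : s, (b i : ℝ) * ⟪(i : E) - y, (i : E) - y⟫ = H₀ * ⟪z - y, z - y⟫
      + ∑ i : s, (b i : ℝ) * ⟪(i : E) - z, (i : E) - z⟫ := by
    intro y
    rw [← hH₀c]
    exact sum_mul_inner_sub_self (fun i : s => (b i : ℝ)) (fun i : s => (i : E)) z y hzsum
  set v := ∑ i : s, (b i : ℝ) * ⟪(i : E) - z, (i : E) - z⟫ with hv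
  have h4 : ∀ i : s, b i ≠ 0 → 4 * H₀ = H₀ * ⟪(i : E) - z, (i : E) - z⟫ + v := by
    intro i hi
    have h1 := hbr i (lt_of_le_of_ne (hb0 i) hi.symm)
    rw [hf] at h1
    simp only [Pi.single_apply, mul_ite, mul_one, mul_zero, Finset.sum_ite_eq', Finset.mem_univ,
      if_true, mul_sub, Finset.sum_sub_distrib] at h1
    have h2 := hzz i
    rw [← neg_sub, inner_neg_neg] at h2
    rw [← h2]
    simp only [hm]
    have h3 : ((∑ j, b j * 2 - ∑ j, b j * m j i : ℤ) : ℝ) = 0 := by exact_mod_cast h1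
    push_cast at h3
    rw [← Finset.sum_mul, hH₀c] at h3
    have : ∑ j : s, (b j : ℝ) * (2 * (m j i : ℝ)) = 2 * ∑ j : s, (b j : ℝ) * (m j i : ℝ) := by
      rw [Finset.mul_sum]; exact Finset.sum_congr rfl fun i _ => by ring
    linarith
  have hv2 : v = 2 * H₀ := by
    have : H₀ * v = H₀ * (4 * H₀ - v) := by
      have e : ∀ i ∈ Finset.univ, (H₀ : ℝ) * ((b i : ℝ) * ⟪(i : E) - z, (i : E) - z⟫) =
          (b i : ℝ) * (4 * H₀ - v) := by
        intro i _
        by_cases hi : b i = 0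
        · simp [hi]
        · rw [h4 i hi]; ring
      conv_lhs => rw [hv, Finset.mul_sum]
      rw [Finset.sum_congr rfl e, ← Finset.sum_mul, hH₀c]
    have := mul_left_cancel₀ hH₀r.ne' this
    linarith
  have hnorm : ∀ i : s, b i ≠ 0 → ⟪(i : E) - z, (i : E) - z⟫ = 2 := by
    intro i hi
    have := h4 i hi
    rw [hv2] at this
    apply mul_left_cancel₀ hH₀r.ne'
    linarith
  choose n hn using fun i : s => hM.even _ (hsM i)
  obtain ⟨N, H, t, hN, ht0, htH, htM, htρ, hadd⟩ := hM.exists_neighbor (x := z) (H₀ := H₀)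
    (κ₀ := ∑ i, b i * n i - H₀) hH₀pos (by
      rw [← hH₀c, ← hzsum]
      refine M.sum_mem fun i _ => ?_
      rw [Int.cast_smul_eq_zsmul]
      exact M.smul_mem _ (hsM i)) (by
      have h := hzz 0
      simp only [sub_zero] at h
      simp only [hn] at h
      have e : ∑ i : s, (b i : ℝ) * (2 * (n i : ℝ)) = 2 * ∑ i : s, (b i : ℝ) * (n i : ℝ) := by
        rw [Finset.mul_sum]; exact Finset.sum_congr rfl fun i _ => by ring
      push_cast
      linarith)
  have := hN.discreteTopology
  set R : Finset E := (ZLattice.finite_inter_closedBall N 0 2).toFinset.filter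
    (fun y => ⟪y, y⟫ = 2) with hRdef
  have hR : ∀ y, y ∈ R ↔ y ∈ N ∧ ⟪y, y⟫ = 2 := by
    intro y
    simp only [hRdef, Finset.mem_filter, Set.Finite.mem_toFinset, Set.mem_inter_iff,
      SetLike.mem_coe, Metric.mem_closedBall, dist_zero_right]
    constructor
    · rintro ⟨⟨h1, -⟩, h2⟩; exact ⟨h1, h2⟩
    · rintro ⟨h1, h2⟩
      refine ⟨⟨h1, ?_⟩, h2⟩
      rw [real_inner_self_eq_norm_sq] at h2
      nlinarith [norm_nonneg y]
  have hHR := hN.heightedRoots hroots ht0 htH htM hadd hR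
  obtain ⟨C, hC⟩ := hdesign N hN R hR
  have hρ : ∀ i : s, (b i : ℝ) ≠ 0 → (i : E) - z ∈ R ∧ t ((i : E) - z) = 1 := by
    intro i hi
    have h2 := hnorm i (by exact_mod_cast hi)
    obtain ⟨h3, h5⟩ := htρ _ (hsM i) h2
    have h6 := (hR _).2 ⟨h3, h2⟩
    have h7 := hHR.pos _ h6
    have h8 := htH ((i : E) - z)
    have h9 : H ≠ 1 := by rintro rfl; simp at h5; omega
    exact ⟨h6, by rw [h5]; exact Int.emod_eq_of_lt (by norm_num) (by omega)⟩
  have hzero : ∑ i : s, (b i : ℝ) • ((i : E) - z) = 0 := by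
    simp only [smul_sub, Finset.sum_sub_distrib, hzsum, ← Finset.sum_smul, sub_self]
  have hclos := fun α (hα : α ∈ R) => hHR.mem_closure hC (fun i : s => (b i : ℝ))
    (fun i : s => (i : E) - z) (by rw [hH₀c]; exact hH₀r) hρ hzero hα
  set y := c - z with hy
  have hin : ∀ ρ ∈ R, t ρ = 1 → ⟪ρ, y⟫ ≤ (2 + ⟪y, y⟫ - r ^ 2) / 2 := by
    intro ρ hρR hρ1
    have h1 := htM ρ ((hR ρ).1 hρR).1
    rw [hρ1, Int.cast_one, one_smul] at h1
    have h2 := hlow2 _ h1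
    have e : ρ + z - c = ρ - y := by rw [hy]; abel
    rw [e, inner_sub_sub_self, ((hR ρ).1 hρR).2, real_inner_comm ρ y] at h2
    linarith
  have hiny : ∀ i : s, (b i : ℝ) * ⟪(i : E) - z, y⟫ = b i * ((2 + ⟪y, y⟫ - r ^ 2) / 2) := by
    intro i
    by_cases hi : b i = 0
    · simp [hi]
    have h2 := hsr i
    have e : (i : E) - c = ((i : E) - z) - y := by rw [hy]; abel
    rw [e, inner_sub_sub_self, hnorm i hi, real_inner_comm _ y] at h2
    congr 1
    linarith
  have hD : (2 + ⟪y, y⟫ - r ^ 2) / 2 = 0 := by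
    have h1 : ⟪∑ i : s, (b i : ℝ) • ((i : E) - z), y⟫ = 0 := by rw [hzero, inner_zero_left]
    rw [sum_inner] at h1
    simp only [real_inner_smul_left, hiny] at h1
    rw [← Finset.sum_mul, hH₀c] at h1
    exact (mul_eq_zero.1 h1).resolve_left hH₀r.ne'
  have hle : ∀ α ∈ R, ⟪α, y⟫ ≤ 0 := by
    intro α hα
    refine AddSubmonoid.closure_induction (motive := fun α _ => ⟪α, y⟫ ≤ 0) ?_ ?_ ?_ (hclos α hα)
    · rintro ρ ⟨h1, h2⟩
      rw [← hD]; exact hin ρ h1 h2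
    · rw [inner_zero_left]
    · intro u v _ _ hu hv
      rw [inner_add_left]; linarith
  have h0 : ∀ α ∈ R, ⟪α, y⟫ = 0 := by
    intro α hα
    have := hle _ (hHR.neg_mem α hα)
    rw [inner_neg_left] at this
    linarith [hle α hα]
  have hCy := hC y
  rw [Finset.sum_eq_zero fun α hα => by rw [h0 α hα]; norm_num] at hCy
  have hC0 : C = 0 := by
    rcases mul_eq_zero.1 hCy.symm with h | h
    · exact h
    · linarith
  obtain ⟨i, hi⟩ : ∃ i, b i ≠ 0 := by
    by_contra! h
    exact hbne (funext h)
  obtain ⟨hiR, -⟩ := hρ i (by exact_mod_cast hi)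
  have hCi := hC ((i : E) - z)
  rw [hC0, zero_mul] at hCi
  have h1 := (Finset.sum_eq_zero_iff_of_nonneg fun α _ => sq_nonneg ⟪α, (i : E) - z⟫).1 hCi _ hiR
  rw [hnorm i hi] at h1
  norm_num at h1

end EvenUnimodular

theorem card_le_two_mul_finrank {E : Type*} [NormedAddCommGroup E] [InnerProductSpace ℝ E]
    [FiniteDimensional ℝ E] (T : Finset E) (h0 : ∀ ν ∈ T, ν ≠ 0)
    (h : ∀ ν ∈ T, ∀ μ ∈ T, ν = μ ∨ ν = -μ ∨ ⟪ν, μ⟫ = 0) : T.card ≤ 2 * Module.finrank ℝ E := by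
  classical
  obtain ⟨U, hU, hmax⟩ := Finset.exists_max_image
    (T.powerset.filter fun U => ∀ ν ∈ U, ∀ μ ∈ U, ν ≠ μ → ⟪ν, μ⟫ = 0) Finset.card
    ⟨∅, by simp⟩
  rw [Finset.mem_filter, Finset.mem_powerset] at hU
  obtain ⟨hUT, hUo⟩ := hU
  have hcard : U.card ≤ Module.finrank ℝ E := by
    have hli : LinearIndependent ℝ fun ν : U => (ν : E) :=
      linearIndependent_of_ne_zero_of_inner_eq_zero (fun ν => h0 ν (hUT ν.2))
        fun ν μ hne => hUo ν ν.2 μ μ.2 fun he => hne (Subtype.ext he)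
    simpa using hli.fintype_card_le_finrank
  have hcov : T ⊆ U ∪ U.image Neg.neg := by
    intro ν hν
    by_contra hcon
    rw [Finset.mem_union, not_or, Finset.mem_image] at hcon
    obtain ⟨hνU, hνn⟩ := hcon
    have hperp : ∀ μ ∈ U, ⟪ν, μ⟫ = 0 := by
      intro μ hμ
      rcases h ν hν μ (hUT hμ) with h | h | h
      · exact absurd (h ▸ hμ) hνU
      · exact absurd ⟨μ, hμ, h.symm⟩ hνn
      · exact h
    have := hmax (insert ν U) (by
      rw [Finset.mem_filter, Finset.mem_powerset]
      refine ⟨Finset.insert_subset hν hUT, ?_⟩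
      intro a ha b hb hab
      rcases Finset.mem_insert.1 ha with ha | ha <;> rcases Finset.mem_insert.1 hb with hb | hb
      · exact absurd (ha.trans hb.symm) hab
      · exact ha ▸ hperp b hb
      · rw [hb, real_inner_comm]; exact hperp a ha
      · exact hUo a ha b hb hab)
    rw [Finset.card_insert_of_notMem hνU] at this
    omega
  calc T.card ≤ _ := Finset.card_le_card hcov
    _ ≤ U.card + (U.image Neg.neg).card := Finset.card_union_le _ _
    _ ≤ U.card + U.card := Nat.add_le_add_left Finset.card_image_le _
    _ ≤ _ := by omega

namespace EvenUnimodular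

variable {E : Type*} [NormedAddCommGroup E] [InnerProductSpace ℝ E] [FiniteDimensional ℝ E]

theorem exists_short_of_card {M : Submodule ℤ E} (hM : EvenUnimodular M)
    (hrank : Module.finrank ℝ E = 24) (hroots : ∀ x ∈ M, ⟪x, x⟫ ≠ 2) (S : ℕ → Finset E)
    (hS : ∀ n y, y ∈ S n ↔ y ∈ M ∧ ⟪y, y⟫ = 2 * n) (h2 : (S 2).card = 196560)
    (h3 : (S 3).card = 16773120) (h4 : (S 4).card = 398034000) {y : E} (hy : y ∈ M) :
    ∃ κ ∈ M, ⟪y - (2 : ℝ) • κ, y - (2 : ℝ) • κ⟫ ≤ 8 := by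
  classical
  have := hM.discreteTopology
  have := hM.isZLattice
  have := ZLattice.module_free ℝ M
  have := ZLattice.module_finite ℝ M
  have hrM : Module.finrank ℤ M = 24 := by rw [ZLattice.rank ℝ M, hrank]
  let b := Module.finBasisOfFinrankEq ℤ M hrM
  let cls : E → (Fin 24 → ZMod 2) := fun y =>
    if h : y ∈ M then fun i => ((b.repr ⟨y, h⟩ i : ℤ) : ZMod 2) else 0
  have hcls : ∀ u ∈ M, ∀ v ∈ M, cls u = cls v → ∃ κ ∈ M, u - v = (2 : ℝ) • κ := by
    intro u hu v hv h
    simp only [cls, dif_pos hu, dif_pos hv] at h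
    have hd : ∀ i, ∃ k : ℤ, b.repr ⟨u, hu⟩ i - b.repr ⟨v, hv⟩ i = 2 * k := fun i =>
      (ZMod.intCast_eq_intCast_iff_dvd_sub _ _ 2).1 (congrFun h i).symm
    choose k hk using hd
    refine ⟨((∑ i, k i • b i : M) : E), Subtype.property _, ?_⟩
    have : (⟨u, hu⟩ - ⟨v, hv⟩ : M) = (2 : ℤ) • ∑ i, k i • b i := by
      rw [← b.sum_repr ⟨u, hu⟩, ← b.sum_repr ⟨v, hv⟩, ← Finset.sum_sub_distrib, Finset.smul_sum]
      refine Finset.sum_congr rfl fun i _ => ?_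
      rw [← sub_smul, hk, smul_smul]
    have := congrArg (fun z : M => (z : E)) this
    simp only [Submodule.coe_sub, Submodule.coe_smul] at this
    rw [this, ← Int.cast_smul_eq_zsmul ℝ]
    norm_num
  have hpar : ∀ u v : E, ⟪u - v, u - v⟫ + ⟪u + v, u + v⟫ = 2 * ⟪u, u⟫ + 2 * ⟪v, v⟫ := by
    intro u v
    rw [inner_sub_sub_self, inner_add_add_self]; ring
  have h16 : ∀ κ ∈ M, (2 : ℝ) • κ ≠ 0 → 16 ≤ ⟪(2 : ℝ) • κ, (2 : ℝ) • κ⟫ := by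
    intro κ hκ hne
    have hκ0 : κ ≠ 0 := by rintro rfl; simp at hne
    obtain ⟨n, hn⟩ := hM.even κ hκ
    have hpos := real_inner_self_pos.2 hκ0
    have h2 := hroots κ hκ
    rw [real_inner_smul_left, real_inner_smul_right, hn]
    rw [hn] at hpos h2
    have hn0 : 0 < n := by
      have : (0 : ℝ) < n := by linarith
      exact_mod_cast this
    have hn1 : n ≠ 1 := by rintro rfl; simp at h2
    have : (2 : ℝ) ≤ n := by exact_mod_cast (by omega : 2 ≤ n)
    linarith
  have hpair : ∀ u ∈ M, ∀ v ∈ M, cls u = cls v → ⟪u, u⟫ ≤ 8 → ⟪v, v⟫ ≤ 8 → u ≠ v → u ≠ -v →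
      ⟪u, u⟫ = 8 ∧ ⟪v, v⟫ = 8 ∧ ⟪u, v⟫ = 0 := by
    intro u hu v hv huv hu8 hv8 hne hne'
    obtain ⟨κ, hκ, hk⟩ := hcls u hu v hv huv
    have hk' : u + v = (2 : ℝ) • (κ + v) := by
      rw [smul_add, ← hk]; module
    have a1 : 16 ≤ ⟪u - v, u - v⟫ := by
      rw [hk]; exact h16 κ hκ (by rw [← hk]; exact sub_ne_zero.2 hne)
    have a2 : 16 ≤ ⟪u + v, u + v⟫ := by
      rw [hk']
      exact h16 _ (M.add_mem hκ hv) (by rw [← hk']; exact fun h => hne' (eq_neg_of_add_eq_zero_left h))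
    have a3 := hpar u v
    have a4 : ⟪u - v, u - v⟫ = ⟪u, u⟫ - 2 * ⟪u, v⟫ + ⟪v, v⟫ := by
      rw [inner_sub_sub_self, real_inner_comm u v]; ring
    refine ⟨by linarith, by linarith, by linarith⟩
  have h0S : ∀ n, n ≠ 0 → (0 : E) ∉ S n := by
    intro n hn h
    have := ((hS n 0).1 h).2
    simp at this
    exact hn this
  have hdisj : ∀ m n, m ≠ n → Disjoint (S m) (S n) := by
    intro m n hmn
    rw [Finset.disjoint_left]
    intro y hy hy'
    have h1 := ((hS m y).1 hy).2
    rw [((hS n y).1 hy').2] at h1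
    have : (n : ℝ) = m := by linarith
    exact hmn (by exact_mod_cast this.symm)
  set T : Finset E := S 0 ∪ S 2 ∪ S 3 ∪ S 4 with hT
  let wt : E → ℕ := fun y => if y ∈ S 4 then 1 else if y = 0 then 48 else 24
  have hTM : ∀ u ∈ T, u ∈ M ∧ ⟪u, u⟫ ≤ 8 := by
    intro u hu
    simp only [hT, Finset.mem_union] at hu
    rcases hu with ((hu | hu) | hu) | hu <;>
      (refine ⟨((hS _ u).1 hu).1, ?_⟩; rw [((hS _ u).1 hu).2]; norm_num)
  have hT4 : ∀ u ∈ T, u ∈ S 4 ↔ ⟪u, u⟫ = 8 := by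
    intro u hu
    rw [hS]
    simp only [(hTM u hu).1, true_and]
    norm_num
  have hclass : ∀ k, ∑ u ∈ T with cls u = k, wt u ≤ 48 := by
    intro k
    by_cases hc : ∃ u ∈ T, cls u = k ∧ ⟪u, u⟫ ≠ 8
    · obtain ⟨u, hu, huk, hu8⟩ := hc
      have hsub : (T.filter fun u => cls u = k) ⊆ {u, -u} := by
        intro v hv
        obtain ⟨hvT, hvk⟩ := Finset.mem_filter.1 hv
        rw [Finset.mem_insert, Finset.mem_singleton]
        by_contra! hcon
        exact hu8 (hpair v (hTM v hvT).1 u (hTM u hu).1 (hvk.trans huk.symm) (hTM v hvT).2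
          (hTM u hu).2 hcon.1 hcon.2).2.1
      refine (Finset.sum_le_sum_of_subset hsub).trans ?_
      have hu4 : u ∉ S 4 := fun h => hu8 ((hT4 u hu).1 h)
      have hu4' : -u ∉ S 4 := fun h => hu8 (by
        have := ((hS 4 _).1 h).2
        rw [inner_neg_neg] at this
        rw [this]; norm_num)
      by_cases h0 : u = 0
      · subst h0
        simp [wt, h0S 4 (by norm_num)]
      · refine (Finset.sum_le_card_nsmul _ wt 24 ?_).trans ?_
        · intro v hv
          rw [Finset.mem_insert, Finset.mem_singleton] at hv
          rcases hv with rfl | rfl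
          · simp [wt, hu4, h0]
          · simp [wt, hu4', h0]
        · rw [smul_eq_mul]
          have := Finset.card_le_two (a := u) (b := -u)
          omega
    · push Not at hc
      have hall : ∀ u ∈ T.filter fun u => cls u = k, wt u = 1 := by
        intro u hu
        obtain ⟨huT, huk⟩ := Finset.mem_filter.1 hu
        simp [wt, (hT4 u huT).2 (hc u huT huk)]
      rw [Finset.sum_congr rfl hall, Finset.sum_const, smul_eq_mul, mul_one]
      have := card_le_two_mul_finrank (T.filter fun u => cls u = k) (by
        intro u hu h0
        obtain ⟨huT, huk⟩ := Finset.mem_filter.1 hu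
        have := hc u huT huk
        rw [h0] at this
        simp at this) (by
        intro u hu v hv
        obtain ⟨huT, huk⟩ := Finset.mem_filter.1 hu
        obtain ⟨hvT, hvk⟩ := Finset.mem_filter.1 hv
        by_cases h1 : u = v
        · exact Or.inl h1
        by_cases h2 : u = -v
        · exact Or.inr (Or.inl h2)
        exact Or.inr (Or.inr (hpair u (hTM u huT).1 v (hTM v hvT).1 (huk.trans hvk.symm)
          (hTM u huT).2 (hTM v hvT).2 h1 h2).2.2))
      rw [hrank] at this
      exact this
  have hS0 : S 0 = {0} := by
    ext u
    rw [hS, Finset.mem_singleton]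
    constructor
    · rintro ⟨-, h⟩
      simpa using h
    · rintro rfl
      simp
  have htotal : ∑ u ∈ T, wt u = 48 * 2 ^ 24 := by
    have d1 : Disjoint (S 0) (S 2) := hdisj _ _ (by norm_num)
    have d2 : Disjoint (S 0 ∪ S 2) (S 3) :=
      Finset.disjoint_union_left.2 ⟨hdisj _ _ (by norm_num), hdisj _ _ (by norm_num)⟩
    have d3 : Disjoint (S 0 ∪ S 2 ∪ S 3) (S 4) :=
      Finset.disjoint_union_left.2 ⟨Finset.disjoint_union_left.2
        ⟨hdisj _ _ (by norm_num), hdisj _ _ (by norm_num)⟩, hdisj _ _ (by norm_num)⟩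
    have e24 : ∀ n, n ≠ 0 → n ≠ 4 → ∀ u ∈ S n, wt u = 24 := by
      intro n hn hn4 u hu
      have hu4 : u ∉ S 4 := Finset.disjoint_left.1 (hdisj n 4 hn4) hu
      have hu0 : u ≠ 0 := by rintro rfl; exact h0S n hn hu
      simp [wt, hu4, hu0]
    have e1 : ∀ u ∈ S 4, wt u = 1 := fun u hu => by simp [wt, hu]
    rw [hT, Finset.sum_union d3, Finset.sum_union d2, Finset.sum_union d1,
      Finset.sum_congr rfl (e24 2 (by norm_num) (by norm_num)),
      Finset.sum_congr rfl (e24 3 (by norm_num) (by norm_num)), Finset.sum_congr rfl e1, hS0]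
    simp only [Finset.sum_const, h2, h3, h4, Finset.sum_singleton]
    simp [wt, h0S 4 (by norm_num)]
  have hfib : ∑ k : Fin 24 → ZMod 2, ∑ u ∈ T with cls u = k, wt u = 48 * 2 ^ 24 := by
    rw [Finset.sum_fiberwise, htotal]
  have hne : ∑ u ∈ T with cls u = cls y, wt u = 48 := by
    have hcardZ : (Finset.univ : Finset (Fin 24 → ZMod 2)).card = 2 ^ 24 := by
      rw [Finset.card_univ, Fintype.card_fun, ZMod.card, Fintype.card_fin]
    have := (Finset.sum_eq_sum_iff_of_le (s := Finset.univ) (g := fun _ => 48)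
      (f := fun k => ∑ u ∈ T with cls u = k, wt u) fun k _ => hclass k).1 (by
        rw [hfib, Finset.sum_const, hcardZ, smul_eq_mul, mul_comm])
    exact this _ (Finset.mem_univ _)
  obtain ⟨u, hu⟩ : (T.filter fun u => cls u = cls y).Nonempty := by
    rw [Finset.nonempty_iff_ne_empty]
    intro h
    rw [h] at hne
    simp at hne
  obtain ⟨huT, huy⟩ := Finset.mem_filter.1 hu
  obtain ⟨κ, hκ, hk⟩ := hcls y hy u (hTM u huT).1 huy.symm
  refine ⟨κ, hκ, ?_⟩
  rw [← hk, sub_sub_cancel]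
  exact (hTM u huT).2

end EvenUnimodular

open MeasureTheory

theorem UnitAddTorus.mFourier_neg_coe {d : Type*} [Fintype d] (m : d → ℤ) (x : d → ℝ) :
    UnitAddTorus.mFourier (-m) (fun i => (x i : UnitAddCircle)) =
      Complex.exp (-2 * Real.pi * Complex.I * ∑ i, (m i : ℂ) * x i) := by
  simp only [UnitAddTorus.mFourier, ContinuousMap.coe_mk, fourier_coe_apply, ← Complex.exp_sum,
    Finset.mul_sum]
  congr 1
  refine Finset.sum_congr rfl fun i _ => ?_
  push_cast [Pi.neg_apply]
  ring

theorem iUnion_pi_Ioc_intCast (d : Type*) :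
    ⋃ n : d → ℤ, {x : d → ℝ | ∀ i, x i ∈ Set.Ioc (n i : ℝ) (n i + 1)} = Set.univ := by
  refine Set.eq_univ_of_forall fun x => Set.mem_iUnion.2 ⟨fun i => ⌈x i⌉ - 1, fun i => ?_⟩
  push_cast
  exact ⟨by linarith [Int.ceil_lt_add_one (x i)], by linarith [Int.le_ceil (x i)]⟩

theorem pairwise_disjoint_pi_Ioc_intCast (d : Type*) :
    Pairwise (Function.onFun Disjoint
      fun n : d → ℤ => {x : d → ℝ | ∀ i, x i ∈ Set.Ioc (n i : ℝ) (n i + 1)}) := by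
  intro m n hmn
  refine Set.disjoint_left.2 fun x hm hn => hmn (funext fun i => ?_)
  have h1 : (m i : ℝ) < n i + 1 := (hm i).1.trans_le (hn i).2
  have h2 : (n i : ℝ) < m i + 1 := (hn i).1.trans_le (hm i).2
  norm_cast at h1 h2
  omega

theorem hasSum_setIntegral_add_intCast {d : Type*} [Fintype d] {g : (d → ℝ) → ℂ}
    (hg : Integrable g) :
    HasSum (fun n : d → ℤ => ∫ x in {x : d → ℝ | ∀ i, x i ∈ Set.Ioc (0 : ℝ) (0 + 1)},
      g (x + fun i => (n i : ℝ))) (∫ x, g x) := by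
  have h := hasSum_integral_iUnion (μ := volume) (f := g)
    (s := fun n : d → ℤ => {x : d → ℝ | ∀ i, x i ∈ Set.Ioc (n i : ℝ) (n i + 1)})
    (fun n => MeasurableSet.univ_pi' fun i => measurableSet_Ioc)
    (pairwise_disjoint_pi_Ioc_intCast d) hg.integrableOn
  rw [iUnion_pi_Ioc_intCast, setIntegral_univ] at h
  convert! h using 2 with n
  have hmp := measurePreserving_add_right (volume : Measure (d → ℝ)) (fun i => (n i : ℝ))
  rw [← hmp.setIntegral_preimage_emb (measurableEmbedding_addRight _) g]
  congr 2
  ext x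
  simp only [Set.mem_ofPred_eq, Set.mem_Ioc, Set.mem_preimage, Pi.add_apply]
  exact forall_congr' fun i => by constructor <;> rintro ⟨h1, h2⟩ <;> constructor <;> linarith

theorem tsum_intCast_eq_tsum_integral {d : Type*} [Fintype d] {f : (d → ℝ) → ℂ}
    (hf : Continuous f) (hfi : Integrable f)
    (hu : ∀ R : ℝ, ∃ u : (d → ℤ) → ℝ, Summable u ∧
      ∀ n x, ‖x‖ ≤ R → ‖f (x + fun i => (n i : ℝ))‖ ≤ u n)
    (hs : Summable fun m : d → ℤ =>
      ∫ x, Complex.exp (-2 * Real.pi * Complex.I * ∑ i, (m i : ℂ) * x i) * f x) :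
    ∑' n : d → ℤ, f (fun i => (n i : ℝ)) = ∑' m : d → ℤ,
      ∫ x, Complex.exp (-2 * Real.pi * Complex.I * ∑ i, (m i : ℂ) * x i) * f x := by
  set G : (d → ℝ) → ℂ := fun x => ∑' n : d → ℤ, f (x + fun i => (n i : ℝ)) with hGdef
  have hG : Continuous G := by
    rw [continuous_iff_continuousAt]
    intro x
    obtain ⟨u, hu, hle⟩ := hu (‖x‖ + 1)
    have : ContinuousOn G (Metric.ball x 1) :=
      continuousOn_tsum (fun n => by fun_prop) hu fun n y hy => hle n y <| by
        have := norm_le_norm_add_norm_sub' y x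
        rw [mem_ball_iff_norm] at hy
        linarith [norm_sub_rev y x]
    exact this.continuousAt (Metric.ball_mem_nhds x one_pos)
  have hper : ∀ x y : d → ℝ, (∀ i, (x i : UnitAddCircle) = y i) → G x = G y := by
    intro x y hxy
    have : ∀ i, ∃ k : ℤ, x i = y i + k := by
      intro i
      obtain ⟨k, hk⟩ := AddSubgroup.mem_zmultiples_iff.1
        ((QuotientAddGroup.eq_iff_sub_mem).1 (hxy i))
      exact ⟨k, by simp at hk; linarith⟩
    choose k hk using this
    simp only [hGdef]
    rw [← (Equiv.addLeft k).tsum_eq fun n : d → ℤ => f (y + fun i => (n i : ℝ))]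
    refine tsum_congr fun n => congrArg f (funext fun i => ?_)
    simp [hk i]; ring
  let q : (d → ℝ) → UnitAddTorus d := fun x i => (x i : UnitAddCircle)
  have hq : IsOpenQuotientMap q :=
    IsOpenQuotientMap.piMap fun _ => QuotientAddGroup.isOpenQuotientMap_mk
  have hFq : ∀ x, (fun t => G (Function.surjInv hq.surjective t)) (q x) = G x := fun x =>
    hper _ _ fun i => congrFun (Function.surjInv_eq hq.surjective (q x)) i
  let F : C(UnitAddTorus d, ℂ) := ⟨fun t => G (Function.surjInv hq.surjective t),
    hq.isQuotientMap.continuous_iff.2 (hG.congr fun x => (hFq x).symm)⟩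
  have hcoeff : ∀ m, UnitAddTorus.mFourierCoeff F m =
      ∫ x, Complex.exp (-2 * Real.pi * Complex.I * ∑ i, (m i : ℂ) * x i) * f x := by
    intro m
    rw [UnitAddTorus.mFourierCoeff_eq_integral _ _ 0]
    have hgi : Integrable fun x : d → ℝ =>
        Complex.exp (-2 * Real.pi * Complex.I * ∑ i, (m i : ℂ) * x i) * f x := by
      refine hfi.bdd_mul (c := 1) (Continuous.aestronglyMeasurable (by fun_prop)) (Filter.Eventually.of_forall fun x => ?_)
      rw [Complex.norm_exp]
      simp [← Complex.ofReal_intCast, ← Complex.ofReal_mul, ← Complex.ofReal_sum]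
    rw [← (hasSum_setIntegral_add_intCast hgi).tsum_eq]
    obtain ⟨u, hu, hle⟩ := hu 1
    have hcube : ∀ x ∈ {x : d → ℝ | ∀ i, x i ∈ Set.Ioc (0 : ℝ) (0 + 1)}, ‖x‖ ≤ 1 := by
      intro x hx
      refine (pi_norm_le_iff_of_nonneg zero_le_one).2 fun i => ?_
      have := hx i
      rw [Real.norm_eq_abs, abs_le]
      constructor <;> linarith [this.1, this.2]
    have hmeas : MeasurableSet {x : d → ℝ | ∀ i, x i ∈ Set.Ioc (0 : ℝ) (0 + 1)} :=
      MeasurableSet.univ_pi' fun i => measurableSet_Ioc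
    have hvol : volume {x : d → ℝ | ∀ i, x i ∈ Set.Ioc (0 : ℝ) (0 + 1)} ≠ ⊤ := by
      have : {x : d → ℝ | ∀ i, x i ∈ Set.Ioc (0 : ℝ) (0 + 1)} ⊆ Metric.closedBall 0 1 :=
        fun x hx => by simpa using hcube x hx
      exact ((measure_mono this).trans_lt measure_closedBall_lt_top).ne
    have hexp : ∀ (n : d → ℤ) (x : d → ℝ),
        Complex.exp (-2 * Real.pi * Complex.I * ∑ i, (m i : ℂ) * ((x i + n i : ℝ) : ℂ)) =
          Complex.exp (-2 * Real.pi * Complex.I * ∑ i, (m i : ℂ) * x i) := by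
      intro n x
      rw [Complex.exp_eq_exp_iff_exists_int]
      refine ⟨-∑ i, m i * n i, ?_⟩
      push_cast
      simp only [mul_add, Finset.sum_add_distrib]
      ring
    have hnorm : ∀ x : d → ℝ,
        ‖Complex.exp (-2 * Real.pi * Complex.I * ∑ i, (m i : ℂ) * x i)‖ = 1 := by
      intro x
      rw [Complex.norm_exp]
      simp [← Complex.ofReal_intCast, ← Complex.ofReal_mul, ← Complex.ofReal_sum]
    rw [integral_tsum_of_summable_integral_norm]
    · refine setIntegral_congr_fun hmeas fun x _ => ?_
      have h1 := UnitAddTorus.mFourier_neg_coe m x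
      have h2 : F (fun i => (x i : UnitAddCircle)) = G x := hFq x
      simp only [Pi.add_apply, hexp, smul_eq_mul]
      rw [h1, h2, tsum_mul_left]
    · intro n
      exact (hgi.comp_add_right _).integrableOn
    · refine Summable.of_nonneg_of_le (fun n => by positivity) (fun n => ?_)
        (hu.mul_right (volume.real {x : d → ℝ | ∀ i, x i ∈ Set.Ioc (0 : ℝ) (0 + 1)}))
      refine (le_abs_self _).trans ((Real.norm_eq_abs _).symm.le.trans ?_)
      refine norm_setIntegral_le_of_norm_le_const hvol.lt_top fun x hx => ?_
      simp only [Pi.add_apply, hexp, norm_norm, norm_mul, hnorm, one_mul]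
      exact hle n x (hcube x hx)
  have h := UnitAddTorus.hasSum_mFourier_series_apply_of_summable (f := F)
    (by simpa only [funext hcoeff] using hs) 0
  have h0 : F 0 = G 0 := hFq 0
  rw [h0] at h
  have h1 : G 0 = ∑' n : d → ℤ, f (fun i => (n i : ℝ)) := by simp [hGdef]
  rw [← h1, ← h.tsum_eq]
  refine tsum_congr fun m => ?_
  rw [hcoeff]
  simp [UnitAddTorus.mFourier]

open scoped RealInnerProductSpace FourierTransform

theorem ZLattice.summable_one_add_norm_pow_inv {E : Type*} [NormedAddCommGroup E]
    [NormedSpace ℝ E] [FiniteDimensional ℝ E] (M : Submodule ℤ E) [DiscreteTopology M]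
    [IsZLattice ℝ M] {N : ℕ} (hN : Module.finrank ℝ E < N) :
    Summable fun z : M => ((1 + ‖(z : E)‖) ^ N)⁻¹ := by
  have hs := ZLattice.summable_norm_pow_inv M N (by rwa [ZLattice.rank ℝ M])
  refine hs.of_norm_bounded_eventually ?_
  filter_upwards [(Set.finite_singleton (0 : M)).compl_mem_cofinite] with z hz
  have hz : 0 < ‖(z : E)‖ := norm_pos_iff.2 fun h => hz (Subtype.ext h)
  rw [norm_inv, norm_pow, Real.norm_of_nonneg (by positivity), ← inv_pow]
  have : ‖z‖ = ‖(z : E)‖ := rfl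
  rw [this]
  gcongr
  linarith

theorem norm_le_of_mul_one_add_norm_pow_le {E : Type*} [NormedAddCommGroup E] {h : E → ℂ}
    {N : ℕ} {A : ℝ} (hA : ∀ x, ‖h x‖ * (1 + ‖x‖) ^ N ≤ A) (x : E) :
    ‖h x‖ ≤ A * ((1 + ‖x‖) ^ N)⁻¹ := by
  rw [← div_eq_mul_inv, le_div_iff₀ (by positivity)]
  exact hA x

theorem integrable_of_mul_one_add_norm_pow_le {E : Type*} [NormedAddCommGroup E]
    [NormedSpace ℝ E] [FiniteDimensional ℝ E] [MeasurableSpace E] [BorelSpace E]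
    (μ : Measure E) [μ.IsAddHaarMeasure] {h : E → ℂ} (hh : Continuous h) {N : ℕ}
    (hN : Module.finrank ℝ E < N) {A : ℝ} (hA : ∀ x, ‖h x‖ * (1 + ‖x‖) ^ N ≤ A) :
    Integrable h μ := by
  have h1 := (integrable_one_add_norm (E := E) (μ := μ) (r := N) (mod_cast hN)).const_mul A
  refine h1.mono' hh.aestronglyMeasurable (Filter.Eventually.of_forall fun x => ?_)
  rw [Real.rpow_neg (by positivity), Real.rpow_natCast]
  exact norm_le_of_mul_one_add_norm_pow_le hA x

namespace EvenUnimodular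

variable {E : Type*} [NormedAddCommGroup E] [InnerProductSpace ℝ E] [FiniteDimensional ℝ E]
  [MeasurableSpace E] [BorelSpace E]

theorem exists_tsum_eq_mul_tsum_fourier {M : Submodule ℤ E} (hM : EvenUnimodular M) :
    ∃ C : ℝ, ∀ (h : E → ℂ) (N : ℕ) (A A' : ℝ), Continuous h → Module.finrank ℝ E < N →
      (∀ x, ‖h x‖ * (1 + ‖x‖) ^ N ≤ A) → (∀ x, ‖𝓕 h x‖ * (1 + ‖x‖) ^ N ≤ A') →
      ∑' z : M, h z = C * ∑' z : M, 𝓕 h z := by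
  have := hM.discreteTopology
  have := hM.isZLattice
  have := ZLattice.module_free ℝ M
  have := ZLattice.module_finite ℝ M
  let ι := Module.Free.ChooseBasisIndex ℤ M
  let b₀ : Module.Basis ι ℤ M := Module.Free.chooseBasis ℤ M
  let b : Module.Basis ι ℝ E := b₀.ofZLatticeBasis ℝ M
  have hb : ∀ i, b i = b₀ i := fun i => b₀.ofZLatticeBasis_apply ℝ M i
  let φ : (ι → ℝ) ≃L[ℝ] E := b.equivFunL.symm
  have hφ : ∀ y, φ y = ∑ i, y i • b i := fun y => b.equivFun_symm_apply y
  have hφn : ∀ n : ι → ℤ, φ (fun i => (n i : ℝ)) = (b₀.equivFun.symm n : E) := by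
    intro n
    rw [hφ, b₀.equivFun_symm_apply]
    push_cast
    refine Finset.sum_congr rfl fun i _ => ?_
    rw [hb, Int.cast_smul_eq_zsmul]
  let c := Measure.addHaarScalarFactor ((volume : Measure (ι → ℝ)).map φ) (volume : Measure E)
  have hhaar : ((volume : Measure (ι → ℝ)).map φ).IsAddHaarMeasure := φ.isAddHaarMeasure_map _
  have hmap : (volume : Measure (ι → ℝ)).map φ = c • (volume : Measure E) :=
    Measure.isAddLeftInvariant_eq_smul _ _
  have hint : ∀ g : E → ℂ, ∫ y, g (φ y) = c * ∫ v, g v := by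
    intro g
    have h1 := integral_map_equiv (μ := volume) φ.toHomeomorph.toMeasurableEquiv g
    have h2 : (volume : Measure (ι → ℝ)).map φ.toHomeomorph.toMeasurableEquiv = c • volume := hmap
    rw [h2, integral_smul_nnreal_measure] at h1
    rw [NNReal.smul_def, Complex.real_smul] at h1
    exact h1.symm
  have hψ : ∀ z : M, ∃ m : ι → ℤ, ∀ i, ⟪(z : E), b i⟫ = m i := by
    intro z
    have : ∀ i, ∃ m : ℤ, ⟪(z : E), b i⟫ = m := fun i =>
      hM.integral z.2 (by rw [hb]; exact (b₀ i).2)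
    choose m hm using this
    exact ⟨m, hm⟩
  choose ψ hψ using hψ
  have hψi : Function.Injective ψ := by
    intro z w hzw
    refine Subtype.ext (InnerProductSpace.ext_inner_right_basis b fun i => ?_)
    rw [hψ, hψ, hzw]
  have hψs : Function.Surjective ψ := by
    intro m
    let w : E := (InnerProductSpace.toDual ℝ E).symm
      (LinearMap.toContinuousLinearMap (b.constr ℝ fun i => (m i : ℝ)))
    have hw : ∀ i, ⟪w, b i⟫ = m i := by
      intro i
      simp [w, InnerProductSpace.toDual_symm_apply]
    have hwM : w ∈ M := by
      refine hM.mem_of_integral w fun y hy => ⟨∑ i, b₀.repr ⟨y, hy⟩ i * m i, ?_⟩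
      have : y = ∑ i, (b₀.repr ⟨y, hy⟩ i : ℝ) • b i := by
        have := congrArg Subtype.val (b₀.sum_repr ⟨y, hy⟩)
        push_cast at this
        refine this.symm.trans (Finset.sum_congr rfl fun i _ => ?_)
        rw [hb, Int.cast_smul_eq_zsmul]
      conv_lhs => rw [this]
      simp [inner_sum, inner_smul_right, hw]
    refine ⟨⟨w, hwM⟩, funext fun i => ?_⟩
    have := hψ ⟨w, hwM⟩ i
    rw [hw i] at this
    exact_mod_cast this.symm
  let Ψ := Equiv.ofBijective ψ ⟨hψi, hψs⟩
  refine ⟨c, fun h N A A' hh hN hA hA' => ?_⟩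
  have hfour : ∀ z : M, ∫ x : ι → ℝ,
      Complex.exp (-2 * Real.pi * Complex.I * ∑ i, (Ψ z i : ℂ) * x i) * h (φ x) =
        c * 𝓕 h z := by
    intro z
    rw [Real.fourier_eq', ← hint]
    congr 1
    ext x
    rw [smul_eq_mul, hφ, sum_inner]
    congr 2
    have : ∀ i, ⟪x i • b i, (z : E)⟫ = Ψ z i * x i := fun i => by
      rw [real_inner_smul_left, real_inner_comm, hψ z i, mul_comm]; rfl
    simp only [this]
    push_cast
    ring
  have hsumm := ZLattice.summable_one_add_norm_pow_inv M hN
  have hA0 : 0 ≤ A := le_trans (by positivity) (hA 0)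
  have key := tsum_intCast_eq_tsum_integral (f := fun y => h (φ y))
    (hh.comp φ.continuous) ?_ ?_ ?_
  · simp only [hφn] at key
    rw [b₀.equivFun.symm.toEquiv.tsum_eq (fun z : M => h z) |>.symm]
    refine key.trans ?_
    rw [← Ψ.tsum_eq, ← tsum_mul_left]
    exact tsum_congr fun z => hfour z
  · have h1 : Integrable h ((volume : Measure (ι → ℝ)).map φ) :=
      integrable_of_mul_one_add_norm_pow_le _ hh hN hA
    exact (integrable_map_equiv φ.toHomeomorph.toMeasurableEquiv h).1 h1
  · intro R
    let R' := ‖(φ : (ι → ℝ) →L[ℝ] E)‖ * |R|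
    have hR' : 0 ≤ R' := by positivity
    refine ⟨fun n => A * (1 + R') ^ N * ((1 + ‖(b₀.equivFun.symm n : E)‖) ^ N)⁻¹,
      ((b₀.equivFun.symm.toEquiv.summable_iff).2 hsumm).mul_left _, fun n x hx => ?_⟩
    have hx' : ‖φ x‖ ≤ R' := ((φ : (ι → ℝ) →L[ℝ] E).le_opNorm x).trans
      (mul_le_mul_of_nonneg_left (hx.trans (le_abs_self R)) (norm_nonneg _))
    rw [map_add, hφn]
    set l : E := (b₀.equivFun.symm n : E)
    have h1 : 1 + ‖l‖ ≤ (1 + R') * (1 + ‖φ x + l‖) := by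
      have := norm_le_norm_add_norm_sub' l (φ x + l)
      have h2 : ‖l - (φ x + l)‖ = ‖φ x‖ := by
        rw [sub_add_cancel_right, norm_neg]
      rw [h2] at this
      nlinarith [mul_nonneg hR' (norm_nonneg (φ x + l))]
    refine (norm_le_of_mul_one_add_norm_pow_le hA _).trans ?_
    change _ ≤ A * (1 + R') ^ N * ((1 + ‖l‖) ^ N)⁻¹
    rw [mul_assoc]
    gcongr
    rw [← div_eq_mul_inv, le_div_iff₀ (by positivity), inv_mul_le_iff₀ (by positivity), mul_comm,
      ← mul_pow]
    gcongr
  · rw [← Ψ.summable_iff]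
    refine Summable.congr (Summable.mul_left (c : ℂ) (f := fun z : M => 𝓕 h z) ?_)
      fun z => (hfour z).symm
    exact (hsumm.mul_left A').of_norm_bounded fun z => norm_le_of_mul_one_add_norm_pow_le hA' z

end EvenUnimodular

theorem exists_one_add_pow_mul_exp_le {c : ℝ} (hc : 0 < c) (n : ℕ) :
    ∃ A : ℝ, 0 ≤ A ∧ ∀ t : ℝ, 0 ≤ t → (1 + t) ^ n * Real.exp (-(c * t ^ 2)) ≤ A := by
  refine ⟨2 ^ n * (n.factorial / c ^ n * Real.exp c), by positivity, fun t ht => ?_⟩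
  have h1 : (1 + t) ^ n ≤ 2 ^ n * (1 + t ^ 2) ^ n := by
    rw [← mul_pow]
    gcongr
    nlinarith [sq_nonneg (t - 1), sq_nonneg t]
  have h2 : (1 + t ^ 2) ^ n ≤ n.factorial / c ^ n * Real.exp (c * (1 + t ^ 2)) := by
    have := Real.pow_div_factorial_le_exp (x := c * (1 + t ^ 2)) (by positivity) n
    rw [div_le_iff₀ (by positivity), mul_pow] at this
    rw [div_mul_eq_mul_div, le_div_iff₀ (by positivity)]
    linarith
  calc (1 + t) ^ n * Real.exp (-(c * t ^ 2))
      ≤ 2 ^ n * (n.factorial / c ^ n * Real.exp (c * (1 + t ^ 2))) *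
          Real.exp (-(c * t ^ 2)) := by
        gcongr
        exact h1.trans (by gcongr)
    _ = _ := by
        rw [mul_assoc, mul_assoc, ← Real.exp_add]
        ring_nf

theorem norm_cexp_pi_mul_I_mul {E : Type*} [NormedAddCommGroup E] (τ : ℂ) (v : E) :
    ‖Complex.exp (Real.pi * Complex.I * τ * (‖v‖ : ℂ) ^ 2)‖ =
      Real.exp (-(Real.pi * τ.im * ‖v‖ ^ 2)) := by
  rw [Complex.norm_exp]
  congr 1
  have : (Real.pi * Complex.I * τ * (‖v‖ : ℂ) ^ 2) =
      ((Real.pi * ‖v‖ ^ 2 : ℝ) : ℂ) * (Complex.I * τ) := by push_cast; ring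
  rw [this, Complex.re_ofReal_mul]
  simp
  ring

theorem exists_norm_mul_one_add_norm_pow_le {E : Type*} [NormedAddCommGroup E] {P : E → ℂ}
    {K : ℝ} {j : ℕ} (hP : ∀ v, ‖P v‖ ≤ K * (1 + ‖v‖) ^ j) {c : ℝ} (hc : 0 < c) (N : ℕ) :
    ∃ A : ℝ, 0 ≤ A ∧ ∀ τ : ℂ, c ≤ τ.im → ∀ v,
      ‖P v * Complex.exp (Real.pi * Complex.I * τ * (‖v‖ : ℂ) ^ 2)‖ * (1 + ‖v‖) ^ N ≤ A := by
  obtain ⟨A, hA0, hA⟩ := exists_one_add_pow_mul_exp_le (mul_pos Real.pi_pos hc) (j + N)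
  refine ⟨|K| * A, by positivity, fun τ hτ v => ?_⟩
  rw [norm_mul, norm_cexp_pi_mul_I_mul]
  calc ‖P v‖ * Real.exp (-(Real.pi * τ.im * ‖v‖ ^ 2)) * (1 + ‖v‖) ^ N
      ≤ (|K| * (1 + ‖v‖) ^ j) * Real.exp (-(Real.pi * c * ‖v‖ ^ 2)) * (1 + ‖v‖) ^ N := by
        gcongr
        exact (hP v).trans (by gcongr; exact le_abs_self K)
    _ = |K| * ((1 + ‖v‖) ^ (j + N) * Real.exp (-(Real.pi * c * ‖v‖ ^ 2))) := by
        rw [pow_add]; ring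
    _ ≤ _ := by gcongr; exact hA _ (norm_nonneg v)

theorem hasDerivAt_cexp_mul_norm_sq {E : Type*} [NormedAddCommGroup E]
    [InnerProductSpace ℝ E] (c : ℂ) (w a : E) :
    HasDerivAt (fun s : ℝ => Complex.exp (c * (‖w + s • a‖ : ℂ) ^ 2))
      (Complex.exp (c * (‖w‖ : ℂ) ^ 2) * (c * (2 * ⟪w, a⟫))) 0 := by
  have h2 : HasDerivAt (fun s : ℝ => w + s • a) a 0 := by
    simpa using ((hasDerivAt_id (0 : ℝ)).smul_const a).const_add w
  have h3 := (h2.norm_sq.ofReal_comp.const_mul c).cexp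
  simpa using h3

theorem norm_inner_ofReal_le {E : Type*} [NormedAddCommGroup E] [InnerProductSpace ℝ E]
    (v a : E) : ‖(⟪v, a⟫ : ℂ)‖ ≤ ‖a‖ * (1 + ‖v‖) := by
  rw [Complex.norm_real]
  refine (norm_inner_le_norm v a).trans ?_
  nlinarith [norm_nonneg v, norm_nonneg a]

section

variable {E : Type*} [NormedAddCommGroup E] [InnerProductSpace ℝ E] [FiniteDimensional ℝ E]
  [MeasurableSpace E] [BorelSpace E]

theorem hasDerivAt_fourier_add_smul {f : E → ℂ} (hf : Integrable f)
    (hvf : Integrable fun v => ‖v‖ * ‖f v‖) (w a : E) :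
    HasDerivAt (fun s : ℝ => 𝓕 f (w + s • a))
      (-(2 * Real.pi * Complex.I) * 𝓕 (fun v => (⟪v, a⟫ : ℂ) * f v) w) 0 := by
  have h1 := Real.hasFDerivAt_fourier hf hvf (w + (0 : ℝ) • a)
  have h2 : HasDerivAt (fun s : ℝ => w + s • a) a 0 := by
    simpa using ((hasDerivAt_id (0 : ℝ)).smul_const a).const_add w
  have h3 := h1.comp_hasDerivAt 0 h2
  have hint : Integrable (VectorFourier.fourierSMulRight (innerSL ℝ) f) := by
    refine (hvf.const_mul (2 * Real.pi * ‖(innerSL ℝ : E →L[ℝ] E →L[ℝ] ℝ)‖)).mono'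
      hf.1.fourierSMulRight (Filter.Eventually.of_forall fun v => ?_)
    refine (VectorFourier.norm_fourierSMulRight_le _ f v).trans_eq ?_
    ring
  convert! h3 using 1
  rw [zero_smul, add_zero, Real.fourier_continuousLinearMap_apply hint, Real.fourier_eq,
    Real.fourier_eq, ← integral_const_mul]
  congr 1
  ext v
  have hva : innerSL ℝ v a = ⟪v, a⟫ := rfl
  simp only [VectorFourier.fourierSMulRight_apply, Circle.smul_def, smul_eq_mul,
    Complex.real_smul, hva]
  ring

theorem integrable_norm_pow_mul_gaussian {P : E → ℂ} (hPc : Continuous P) {K : ℝ} {j : ℕ}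
    (hP : ∀ v, ‖P v‖ ≤ K * (1 + ‖v‖) ^ j) {τ : ℂ} (hτ : 0 < τ.im) :
    Integrable fun v => P v * Complex.exp (Real.pi * Complex.I * τ * (‖v‖ : ℂ) ^ 2) := by
  obtain ⟨A, -, hA⟩ := exists_norm_mul_one_add_norm_pow_le hP hτ (Module.finrank ℝ E + 1)
  exact integrable_of_mul_one_add_norm_pow_le _ (by fun_prop) (Nat.lt_succ_self _) (hA τ le_rfl)

theorem fourier_exp_pi_mul_I (hrank : Module.finrank ℝ E = 24) {τ : ℂ} (hτ : 0 < τ.im) (w : E) :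
    𝓕 (fun v : E => Complex.exp (Real.pi * Complex.I * τ * (‖v‖ : ℂ) ^ 2)) w =
      (τ ^ 12)⁻¹ * Complex.exp (Real.pi * Complex.I * (-1 / τ) * (‖w‖ : ℂ) ^ 2) := by
  have hτ0 : τ ≠ 0 := fun h => by simp [h] at hτ
  have hb : 0 < (-(Real.pi * Complex.I * τ)).re := by
    have : (-(Real.pi * Complex.I * τ)) = ((-Real.pi : ℝ) : ℂ) * (Complex.I * τ) := by
      push_cast; ring
    rw [this, Complex.re_ofReal_mul]
    simpa using mul_pos Real.pi_pos hτ
  have h := fourier_gaussian_innerProductSpace hb w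
  simp only [neg_neg] at h
  rw [h, hrank]
  have hpi : (Real.pi : ℂ) ≠ 0 := by exact_mod_cast Real.pi_ne_zero
  have h1 : (Real.pi : ℂ) / -(Real.pi * Complex.I * τ) = Complex.I / τ := by
    field_simp
    simp
  congr 1
  · rw [h1, show ((24 : ℕ) : ℂ) / 2 = ((12 : ℕ) : ℂ) by norm_num, Complex.cpow_natCast, div_pow,
      show (12 : ℕ) = 4 * 3 by norm_num, pow_mul, Complex.I_pow_four]
    simp
  · congr 1
    field_simp
    simp

theorem fourier_inner_mul_exp (hrank : Module.finrank ℝ E = 24) {τ : ℂ} (hτ : 0 < τ.im)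
    (a w : E) :
    𝓕 (fun v : E => (⟪v, a⟫ : ℂ) * Complex.exp (Real.pi * Complex.I * τ * (‖v‖ : ℂ) ^ 2)) w =
      (τ ^ 13)⁻¹ * (⟪w, a⟫ *
        Complex.exp (Real.pi * Complex.I * (-1 / τ) * (‖w‖ : ℂ) ^ 2)) := by
  have hτ0 : τ ≠ 0 := fun h => by simp [h] at hτ
  have hpi : (2 * Real.pi * Complex.I : ℂ) ≠ 0 := Complex.two_pi_I_ne_zero
  have hi0 := integrable_norm_pow_mul_gaussian (E := E) (P := fun _ => 1) (K := 1) (j := 0)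
    continuous_const (by simp) hτ
  have hi1 := integrable_norm_pow_mul_gaussian (E := E) (P := fun v => (‖v‖ : ℂ)) (K := 1) (j := 1)
    (by fun_prop) (fun v => by simp) hτ
  simp only [one_mul] at hi0
  have h := hasDerivAt_fourier_add_smul hi0 (by simpa [norm_mul] using hi1.norm) w a
  simp only [fourier_exp_pi_mul_I hrank hτ] at h
  have h' := (hasDerivAt_cexp_mul_norm_sq (Real.pi * Complex.I * (-1 / τ)) w a).const_mul
    (τ ^ 12)⁻¹
  have := h.unique h'
  refine mul_left_cancel₀ (neg_ne_zero.2 hpi) (this.trans ?_)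
  field_simp

theorem fourier_inner_sq_mul_exp (hrank : Module.finrank ℝ E = 24) {τ : ℂ} (hτ : 0 < τ.im)
    (a w : E) :
    𝓕 (fun v : E => (⟪v, a⟫ : ℂ) *
        ((⟪v, a⟫ : ℂ) * Complex.exp (Real.pi * Complex.I * τ * (‖v‖ : ℂ) ^ 2))) w =
      ((τ ^ 14)⁻¹ * ⟪w, a⟫ ^ 2 - (τ ^ 13)⁻¹ / (2 * Real.pi * Complex.I) * ‖a‖ ^ 2) *
        Complex.exp (Real.pi * Complex.I * (-1 / τ) * (‖w‖ : ℂ) ^ 2) := by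
  have hτ0 : τ ≠ 0 := fun h => by simp [h] at hτ
  have hpi : (2 * Real.pi * Complex.I : ℂ) ≠ 0 := Complex.two_pi_I_ne_zero
  have hi0 := integrable_norm_pow_mul_gaussian (E := E) (P := fun v => (⟪v, a⟫ : ℂ)) (K := ‖a‖)
    (j := 1) (by fun_prop) (fun v => by simpa using norm_inner_ofReal_le v a) hτ
  have hi1 := integrable_norm_pow_mul_gaussian (E := E) (P := fun v => (‖v‖ : ℂ) * ⟪v, a⟫)
    (K := ‖a‖) (j := 2) (by fun_prop) (fun v => by
      rw [norm_mul]
      have h1 := norm_inner_ofReal_le v a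
      have h2 : ‖(‖v‖ : ℂ)‖ ≤ 1 + ‖v‖ := by simp
      calc _ ≤ (1 + ‖v‖) * (‖a‖ * (1 + ‖v‖)) := by gcongr
        _ = _ := by ring) hτ
  have h := hasDerivAt_fourier_add_smul hi0 (by simpa [norm_mul, mul_assoc] using hi1.norm) w a
  simp only [fourier_inner_mul_exp hrank hτ] at h
  have h2 : HasDerivAt (fun s : ℝ => (⟪w + s • a, a⟫ : ℂ)) ((‖a‖ : ℂ) ^ 2) 0 := by
    have := ((((hasDerivAt_id (0 : ℝ)).smul_const a).const_add w).inner ℝ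
      (hasDerivAt_const (0 : ℝ) a)).ofReal_comp
    simpa [real_inner_self_eq_norm_sq] using this
  have h' := (h2.mul (hasDerivAt_cexp_mul_norm_sq (Real.pi * Complex.I * (-1 / τ)) w a)).const_mul
    (τ ^ 13)⁻¹
  have := h.unique h'
  refine mul_left_cancel₀ (neg_ne_zero.2 hpi) (this.trans ?_)
  rw [zero_smul, add_zero]
  field_simp
  ring

end

open scoped RealInnerProductSpace FourierTransform MatrixGroups

namespace EvenUnimodular

section

variable {E : Type*} [NormedAddCommGroup E] [InnerProductSpace ℝ E] [FiniteDimensional ℝ E]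

theorem exists_summable_norm_theta_term_le {M : Submodule ℤ E} (hM : EvenUnimodular M)
    {P : E → ℂ} {K : ℝ} {j : ℕ} (hP : ∀ v, ‖P v‖ ≤ K * (1 + ‖v‖) ^ j) {c : ℝ} (hc : 0 < c) :
    ∃ u : M → ℝ, Summable u ∧ ∀ τ : ℂ, c ≤ τ.im → ∀ z : M,
      ‖P z * Complex.exp (Real.pi * Complex.I * τ * (‖(z : E)‖ : ℂ) ^ 2)‖ ≤ u z := by
  have := hM.discreteTopology
  have := hM.isZLattice
  obtain ⟨A, -, hA⟩ := exists_norm_mul_one_add_norm_pow_le hP hc (Module.finrank ℝ E + 1)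
  exact ⟨_, (ZLattice.summable_one_add_norm_pow_inv M (Nat.lt_succ_self _)).mul_left A,
    fun τ hτ z => norm_le_of_mul_one_add_norm_pow_le
      (h := fun v => P v * Complex.exp (Real.pi * Complex.I * τ * (‖v‖ : ℂ) ^ 2)) (hA τ hτ) z⟩

theorem differentiableOn_theta {M : Submodule ℤ E} (hM : EvenUnimodular M)
    {P : E → ℂ} {K : ℝ} {j : ℕ} (hP : ∀ v, ‖P v‖ ≤ K * (1 + ‖v‖) ^ j) :
    DifferentiableOn ℂ (fun τ : ℂ => ∑' z : M,
      P z * Complex.exp (Real.pi * Complex.I * τ * (‖(z : E)‖ : ℂ) ^ 2)) {τ | 0 < τ.im} := by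
  intro τ hτ
  have hτ : 0 < τ.im := hτ
  obtain ⟨u, hu, hle⟩ := hM.exists_summable_norm_theta_term_le hP (half_pos hτ)
  have hU : IsOpen {w : ℂ | τ.im / 2 < w.im} := isOpen_lt continuous_const Complex.continuous_im
  have hmem : τ ∈ {w : ℂ | τ.im / 2 < w.im} := half_lt_self hτ
  exact ((Complex.differentiableOn_tsum_of_summable_norm hu (fun z => by fun_prop) hU
    fun z w hw => hle w (le_of_lt hw) z).differentiableAt
      (hU.mem_nhds hmem)).differentiableWithinAt

theorem hasSum_theta {M : Submodule ℤ E} (hM : EvenUnimodular M) {P : E → ℂ} {K : ℝ} {j : ℕ}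
    (hP : ∀ v, ‖P v‖ ≤ K * (1 + ‖v‖) ^ j) {S : ℕ → Finset E}
    (hS : ∀ n y, y ∈ S n ↔ y ∈ M ∧ ⟪y, y⟫ = 2 * n) {τ : ℂ} (hτ : 0 < τ.im) :
    HasSum (fun m : ℕ => (∑ y ∈ S m, P y) • Function.Periodic.qParam 1 τ ^ m)
      (∑' z : M, P z * Complex.exp (Real.pi * Complex.I * τ * (‖(z : E)‖ : ℂ) ^ 2)) := by
  obtain ⟨u, hu, hle⟩ := hM.exists_summable_norm_theta_term_le hP hτ
  have hs := (hu.of_norm_bounded (hle τ le_rfl)).hasSum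
  have hν : ∀ z : M, ∃ n : ℕ, ⟪(z : E), (z : E)⟫ = 2 * n := by
    intro z
    obtain ⟨n, hn⟩ := hM.even z z.2
    have : 0 ≤ n := by
      have : (0 : ℝ) ≤ 2 * n := hn ▸ real_inner_self_nonneg
      exact_mod_cast (by linarith : (0 : ℝ) ≤ n)
    obtain ⟨k, rfl⟩ := Int.eq_ofNat_of_zero_le this
    exact ⟨k, by simpa using hn⟩
  choose ν hν using hν
  refine (hs.tsum_fiberwise ν).congr_fun fun m => ?_
  let e : ν ⁻¹' {m} ≃ S m :=
    { toFun z := ⟨z.1, (hS m _).2 ⟨z.1.2, by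
        have := z.2
        rw [Set.mem_preimage, Set.mem_singleton_iff] at this
        rw [hν, this]⟩⟩
      invFun y := ⟨⟨y.1, ((hS m _).1 y.2).1⟩, by
        have := ((hS m _).1 y.2).2
        rw [hν ⟨y.1, ((hS m _).1 y.2).1⟩] at this
        rw [Set.mem_preimage, Set.mem_singleton_iff]
        exact_mod_cast (by linarith : ((ν ⟨y.1, ((hS m _).1 y.2).1⟩ : ℕ) : ℝ) = m)⟩
      left_inv _ := rfl
      right_inv _ := rfl }
  rw [← e.symm.tsum_eq, tsum_fintype, smul_eq_mul, Finset.sum_mul, ← Finset.sum_coe_sort (S m)]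
  refine Finset.sum_congr rfl fun y _ => ?_
  have h1 : ((e.symm y).1 : E) = y := rfl
  rw [h1]
  congr 1
  have h2 : ‖(y : E)‖ ^ 2 = 2 * m := by
    rw [← real_inner_self_eq_norm_sq, ((hS m _).1 y.2).2]
  have h3 : (‖(y : E)‖ : ℂ) ^ 2 = 2 * m := by exact_mod_cast congrArg (fun r : ℝ => (r : ℂ)) h2
  rw [h3, Function.Periodic.qParam, ← Complex.exp_nat_mul]
  congr 1
  push_cast
  ring

end

variable {E : Type*} [NormedAddCommGroup E] [InnerProductSpace ℝ E] [FiniteDimensional ℝ E]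
  [MeasurableSpace E] [BorelSpace E]

theorem theta_inversion {M : Submodule ℤ E} (hM : EvenUnimodular M)
    (hrank : Module.finrank ℝ E = 24) {P : E → ℂ} (hPc : Continuous P) {K : ℝ} {j : ℕ}
    (hP : ∀ v, ‖P v‖ ≤ K * (1 + ‖v‖) ^ j) {k : ℕ}
    (hF : ∀ τ : ℂ, 0 < τ.im → ∀ w,
      𝓕 (fun v => P v * Complex.exp (Real.pi * Complex.I * τ * (‖v‖ : ℂ) ^ 2)) w =
        (τ ^ k)⁻¹ * (P w * Complex.exp (Real.pi * Complex.I * (-1 / τ) * (‖w‖ : ℂ) ^ 2)))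
    {τ : ℂ} (hτ : 0 < τ.im) :
    ∑' z : M, P z * Complex.exp (Real.pi * Complex.I * τ * (‖(z : E)‖ : ℂ) ^ 2) =
      (τ ^ k)⁻¹ * ∑' z : M,
        P z * Complex.exp (Real.pi * Complex.I * (-1 / τ) * (‖(z : E)‖ : ℂ) ^ 2) := by
  obtain ⟨C, hC⟩ := hM.exists_tsum_eq_mul_tsum_fourier
  have key : ∀ (P : E → ℂ) (K : ℝ) (j k : ℕ), Continuous P →
      (∀ v, ‖P v‖ ≤ K * (1 + ‖v‖) ^ j) → (∀ τ : ℂ, 0 < τ.im → ∀ w,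
      𝓕 (fun v => P v * Complex.exp (Real.pi * Complex.I * τ * (‖v‖ : ℂ) ^ 2)) w =
        (τ ^ k)⁻¹ * (P w * Complex.exp (Real.pi * Complex.I * (-1 / τ) * (‖w‖ : ℂ) ^ 2))) →
      ∀ τ : ℂ, 0 < τ.im →
      ∑' z : M, P z * Complex.exp (Real.pi * Complex.I * τ * (‖(z : E)‖ : ℂ) ^ 2) =
      C * ((τ ^ k)⁻¹ * ∑' z : M,
        P z * Complex.exp (Real.pi * Complex.I * (-1 / τ) * (‖(z : E)‖ : ℂ) ^ 2)) := by
    intro P K j k hPc hP hF τ hτ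
    have hτ' : 0 < (-1 / τ).im := by
      rw [neg_div, one_div, Complex.neg_im, Complex.inv_im, neg_div, neg_neg]
      have hτ0 : τ ≠ 0 := fun h => by simp [h] at hτ
      exact div_pos hτ (Complex.normSq_pos.2 hτ0)
    obtain ⟨A, -, hA⟩ := exists_norm_mul_one_add_norm_pow_le hP hτ (Module.finrank ℝ E + 1)
    obtain ⟨A', -, hA'⟩ := exists_norm_mul_one_add_norm_pow_le hP hτ' (Module.finrank ℝ E + 1)
    have := hC (fun v => P v * Complex.exp (Real.pi * Complex.I * τ * (‖v‖ : ℂ) ^ 2))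
      (Module.finrank ℝ E + 1) A (‖(τ ^ k)⁻¹‖ * A') (by fun_prop) (Nat.lt_succ_self _)
      (hA τ le_rfl) fun w => by
        rw [hF τ hτ, norm_mul, mul_assoc]
        exact mul_le_mul_of_nonneg_left (hA' _ le_rfl w) (norm_nonneg _)
    rw [this]
    congr 1
    rw [← tsum_mul_left]
    exact tsum_congr fun z : M => hF τ hτ z
  have hC1 : (C : ℂ) = 1 := by
    have h := key (fun _ => 1) 1 0 12 continuous_const (by simp)
      (fun τ hτ w => by simpa using fourier_exp_pi_mul_I hrank hτ w) Complex.I (by simp)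
    have hI : (-1 : ℂ) / Complex.I = Complex.I := by
      rw [Complex.div_I]; simp
    rw [hI, show (12 : ℕ) = 4 * 3 by norm_num, pow_mul, Complex.I_pow_four, one_pow, inv_one,
      one_mul] at h
    have hne : ∑' z : M, (1 : ℂ) *
        Complex.exp (Real.pi * Complex.I * Complex.I * (‖(z : E)‖ : ℂ) ^ 2) ≠ 0 := by
      obtain ⟨u, hu, hle⟩ := hM.exists_summable_norm_theta_term_le (P := fun _ => 1) (K := 1)
        (j := 0) (by simp) one_pos
      have hterm : ∀ z : M, (1 : ℂ) *
          Complex.exp (Real.pi * Complex.I * Complex.I * (‖(z : E)‖ : ℂ) ^ 2) =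
          ((Real.exp (-(Real.pi * ‖(z : E)‖ ^ 2)) : ℝ) : ℂ) := by
        intro z
        rw [one_mul, Complex.ofReal_exp, mul_assoc (Real.pi : ℂ), Complex.I_mul_I]
        push_cast
        ring_nf
      have hsum : Summable fun z : M => Real.exp (-(Real.pi * ‖(z : E)‖ ^ 2)) := by
        refine hu.of_nonneg_of_le (fun z => (Real.exp_pos _).le) fun z => ?_
        have := hle Complex.I (by simp) z
        simp only [hterm, Complex.norm_real, Real.norm_eq_abs, Real.abs_exp] at this
        exact this
      simp only [hterm, ← Complex.ofReal_tsum]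
      rw [Complex.ofReal_ne_zero]
      exact (hsum.tsum_pos (fun z => (Real.exp_pos _).le) 0 (Real.exp_pos _)).ne'
    exact mul_right_cancel₀ hne (h.symm.trans (one_mul _).symm)
  rw [key P K j k hPc hP hF τ hτ, hC1, one_mul]

theorem exists_modularForm_qExpansion_coeff {M : Submodule ℤ E} (hM : EvenUnimodular M)
    (hrank : Module.finrank ℝ E = 24) {P : E → ℂ} (hPc : Continuous P) {K : ℝ} {j : ℕ}
    (hP : ∀ v, ‖P v‖ ≤ K * (1 + ‖v‖) ^ j) {k : ℕ}
    (hF : ∀ τ : ℂ, 0 < τ.im → ∀ w,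
      𝓕 (fun v => P v * Complex.exp (Real.pi * Complex.I * τ * (‖v‖ : ℂ) ^ 2)) w =
        (τ ^ k)⁻¹ * (P w * Complex.exp (Real.pi * Complex.I * (-1 / τ) * (‖w‖ : ℂ) ^ 2)))
    {S : ℕ → Finset E} (hS : ∀ n y, y ∈ S n ↔ y ∈ M ∧ ⟪y, y⟫ = 2 * n) :
    ∃ f : ModularForm 𝒮ℒ k, ∀ m : ℕ,
      (UpperHalfPlane.qExpansion 1 f).coeff m = ∑ y ∈ S m, P y := by
  let Θ : ℂ → ℂ := fun τ => ∑' z : M,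
    P z * Complex.exp (Real.pi * Complex.I * τ * (‖(z : E)‖ : ℂ) ^ 2)
  let θ : UpperHalfPlane → ℂ := fun τ => Θ τ
  have hq : ∀ τ : UpperHalfPlane,
      HasSum (fun m : ℕ => (∑ y ∈ S m, P y) • Function.Periodic.qParam 1 τ ^ m) (θ τ) :=
    fun τ => hM.hasSum_theta hP hS τ.im_pos
  have hSl : SlashAction.map (k : ℤ) ModularGroup.S θ = θ := by
    ext τ
    rw [ModularForm.SL_slash_apply, UpperHalfPlane.modular_S_smul]
    have h1 : UpperHalfPlane.denom (Matrix.SpecialLinearGroup.toGL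
        ((Matrix.SpecialLinearGroup.map (Int.castRingHom ℝ)) ModularGroup.S)) (τ : ℂ) = τ := by
      change ((((ModularGroup.S 1 0 : ℤ) : ℝ) : ℂ) * τ + (((ModularGroup.S 1 1 : ℤ) : ℝ) : ℂ)) = _
      simp [ModularGroup.S]
    have h2 : Θ τ = ((τ : ℂ) ^ k)⁻¹ * Θ (-1 / τ) := hM.theta_inversion hrank hPc hP hF τ.im_pos
    rw [h1, zpow_neg, zpow_natCast]
    change Θ ((-(τ : ℂ))⁻¹) * _ = Θ τ
    rw [h2, mul_comm, inv_neg, neg_div, one_div]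
  have hTl : SlashAction.map (k : ℤ) ModularGroup.T θ = θ := by
    ext τ
    rw [ModularForm.SL_slash_apply, UpperHalfPlane.modular_T_smul]
    have h1 : UpperHalfPlane.denom (Matrix.SpecialLinearGroup.toGL
        ((Matrix.SpecialLinearGroup.map (Int.castRingHom ℝ)) ModularGroup.T)) (τ : ℂ) = 1 := by
      change ((((ModularGroup.T 1 0 : ℤ) : ℝ) : ℂ) * τ + (((ModularGroup.T 1 1 : ℤ) : ℝ) : ℂ)) = _
      simp [ModularGroup.T]
    rw [h1, one_zpow, mul_one]
    refine (hq _).unique ?_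
    convert! hq τ using 4 with m
    rw [UpperHalfPlane.coe_vadd]
    have := Complex.exp_periodic (2 * Real.pi * Complex.I * τ)
    simp only [Function.Periodic.qParam, Complex.ofReal_one, div_one]
    rw [← this]
    ring_nf
  let f : ModularForm 𝒮ℒ k :=
    { toFun := θ
      slash_action_eq' := by
        rintro _ ⟨γ, rfl⟩
        exact SlashInvariantForm.slash_action_generators_SL2Z hSl hTl γ
      holo' := by
        rw [UpperHalfPlane.mdifferentiable_iff]
        refine (hM.differentiableOn_theta hP).congr fun τ hτ => ?_
        simp [θ, Θ, UpperHalfPlane.ofComplex_apply_of_im_pos hτ]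
      bdd_at_cusps' := by
        intro c hc
        rw [Subgroup.IsArithmetic.isCusp_iff_isCusp_SL2Z] at hc
        rw [OnePoint.isBoundedAt_iff_forall_SL2Z hc]
        intro γ _
        rw [SlashInvariantForm.slash_action_generators_SL2Z hSl hTl]
        exact UpperHalfPlane.isBoundedAtImInfty_of_hasSum_qExpansion one_pos hq }
  exact ⟨f, fun m => (ModularFormClass.qExpansion_coeff_unique (f := f) one_pos
    one_mem_strictPeriods_SL hq m).symm⟩

end EvenUnimodular

namespace ModularForm

theorem qExpansion_coeff_of_weight_twelve (f : ModularForm 𝒮ℒ (12 : ℕ))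
    (h0 : (UpperHalfPlane.qExpansion 1 f).coeff 0 = 1)
    (h1 : (UpperHalfPlane.qExpansion 1 f).coeff 1 = 0) :
    (UpperHalfPlane.qExpansion 1 f).coeff 2 = 196560 ∧
    (UpperHalfPlane.qExpansion 1 f).coeff 3 = 16773120 ∧
    (UpperHalfPlane.qExpansion 1 f).coeff 4 = 398034000 := by
  let E4 := ModularForm.E (k := 4) (by norm_num)
  let E6 := ModularForm.E (k := 6) (by norm_num)
  let E8 := ModularForm.E (k := 8) (by norm_num)
  let g : ModularForm 𝒮ℒ (12 : ℕ) := E4.mul E8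
  let h : ModularForm 𝒮ℒ (12 : ℕ) := E6.mul E6
  have hb4 : bernoulli 4 = -1 / 30 := by decide +kernel
  have hb6 : bernoulli 6 = 1 / 42 := by decide +kernel
  have hb8 : bernoulli 8 = -1 / 30 := by decide +kernel
  have hE4 : ∀ m, (UpperHalfPlane.qExpansion 1 E4).coeff m =
      if m = 0 then 1 else 240 * (ArithmeticFunction.sigma 3 m : ℂ) := by
    intro m
    rw [EisensteinSeries.E_qExpansion_coeff _ (by decide), hb4]
    norm_num
  have hE6 : ∀ m, (UpperHalfPlane.qExpansion 1 E6).coeff m =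
      if m = 0 then 1 else -504 * (ArithmeticFunction.sigma 5 m : ℂ) := by
    intro m
    rw [EisensteinSeries.E_qExpansion_coeff _ (by decide), hb6]
    norm_num
  have hE8 : ∀ m, (UpperHalfPlane.qExpansion 1 E8).coeff m =
      if m = 0 then 1 else 480 * (ArithmeticFunction.sigma 7 m : ℂ) := by
    intro m
    rw [EisensteinSeries.E_qExpansion_coeff _ (by decide), hb8]
    norm_num
  have hg : UpperHalfPlane.qExpansion 1 g =
      UpperHalfPlane.qExpansion 1 E4 * UpperHalfPlane.qExpansion 1 E8 :=
    ModularForm.qExpansion_mul one_pos one_mem_strictPeriods_SL E4 E8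
  have hh : UpperHalfPlane.qExpansion 1 h =
      UpperHalfPlane.qExpansion 1 E6 * UpperHalfPlane.qExpansion 1 E6 :=
    ModularForm.qExpansion_mul one_pos one_mem_strictPeriods_SL E6 E6
  have key : UpperHalfPlane.qExpansion 1 ⇑(f - ((7 / 12 : ℂ) • g + (5 / 12 : ℂ) • h)) =
      UpperHalfPlane.qExpansion 1 f - ((7 / 12 : ℂ) • UpperHalfPlane.qExpansion 1 g +
        (5 / 12 : ℂ) • UpperHalfPlane.qExpansion 1 h) := by
    rw [FunLike.coe_sub, ModularForm.qExpansion_sub one_pos one_mem_strictPeriods_SL,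
      FunLike.coe_add, ModularForm.qExpansion_add one_pos one_mem_strictPeriods_SL,
      FunLike.coe_smul, ModularForm.qExpansion_smul one_pos one_mem_strictPeriods_SL,
      FunLike.coe_smul, ModularForm.qExpansion_smul one_pos one_mem_strictPeriods_SL]
  have hd4 : Nat.divisors 4 = {1, 2, 4} := by decide
  have ha0 : Finset.HasAntidiagonal.antidiagonal 0 = {(0, 0)} := by decide
  have ha1 : Finset.HasAntidiagonal.antidiagonal 1 = {(0, 1), (1, 0)} := by decide
  have ha2 : Finset.HasAntidiagonal.antidiagonal 2 = {(0, 2), (1, 1), (2, 0)} := by decide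
  have ha3 : Finset.HasAntidiagonal.antidiagonal 3 = {(0, 3), (1, 2), (2, 1), (3, 0)} := by decide
  have ha4 : Finset.HasAntidiagonal.antidiagonal 4 = {(0, 4), (1, 3), (2, 2), (3, 1), (4, 0)} := by decide
  have hzero : f - ((7 / 12 : ℂ) • g + (5 / 12 : ℂ) • h) = 0 := by
    refine ModularForm.sturm_bound_levelOne_nat (lt_of_lt_of_le ?_
      (PowerSeries.nat_le_order _ 2 fun i hi => ?_))
    · norm_num
    · rw [key, hg, hh]
      interval_cases i
      · simp only [map_sub, map_add, PowerSeries.coeff_smul, PowerSeries.coeff_mul, h0, ha0, hE4,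
          hE6, hE8]
        norm_num
      · simp only [map_sub, map_add, PowerSeries.coeff_smul, PowerSeries.coeff_mul, h1, ha1, hE4,
          hE6, hE8]
        norm_num
  have hf : ∀ m, (UpperHalfPlane.qExpansion 1 f).coeff m =
      (7 / 12) * (UpperHalfPlane.qExpansion 1 E4 * UpperHalfPlane.qExpansion 1 E8).coeff m +
      (5 / 12) * (UpperHalfPlane.qExpansion 1 E6 * UpperHalfPlane.qExpansion 1 E6).coeff m := by
    intro m
    have := congrArg (fun p => p.coeff m)
      ((ModularForm.qExpansion_eq_zero_iff one_pos one_mem_strictPeriods_SL _).2 hzero)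
    rw [key, hg, hh] at this
    simpa [sub_eq_zero] using this
  refine ⟨?_, ?_, ?_⟩
  · simp only [hf, PowerSeries.coeff_mul, ha2, hE4, hE6, hE8]
    norm_num [ArithmeticFunction.sigma_apply]
  · simp only [hf, PowerSeries.coeff_mul, ha3, hE4, hE6, hE8]
    norm_num [ArithmeticFunction.sigma_apply]
  · simp only [hf, PowerSeries.coeff_mul, ha4, hE4, hE6, hE8]
    norm_num [ArithmeticFunction.sigma_apply, hd4]

theorem qExpansion_eq_zero_of_weight_fourteen (f : ModularForm 𝒮ℒ (14 : ℕ))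
    (h0 : (UpperHalfPlane.qExpansion 1 f).coeff 0 = 0) : UpperHalfPlane.qExpansion 1 f = 0 := by
  have h : ∀ g : ModularForm 𝒮ℒ (((14 : ℕ) : ℤ) - 12), g = 0 := by
    change ∀ g : ModularForm 𝒮ℒ 2, g = 0
    exact rank_zero_iff_forall_zero.1 ModularForm.levelOne_weight_two_rank_zero
  rw [ModularForm.qExpansion_eq_qExpansion_discriminant_mul f h0,
    (ModularForm.qExpansion_eq_zero_iff one_pos one_mem_strictPeriods_SL _).2 (h _), mul_zero]

end ModularForm

namespace EvenUnimodular

variable {E : Type*} [NormedAddCommGroup E] [InnerProductSpace ℝ E] [FiniteDimensional ℝ E]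

theorem exists_finset_norm_shell {M : Submodule ℤ E} (hM : EvenUnimodular M) :
    ∃ S : ℕ → Finset E, ∀ n y, y ∈ S n ↔ y ∈ M ∧ ⟪y, y⟫ = 2 * n := by
  have := hM.discreteTopology
  have hfin : ∀ n : ℕ, {y : E | y ∈ M ∧ ⟪y, y⟫ = 2 * n}.Finite := fun n =>
    (ZLattice.finite_inter_closedBall M 0 (Real.sqrt (2 * n))).subset fun y hy =>
      ⟨hy.1, by
        rw [mem_closedBall_zero_iff, ← hy.2, real_inner_self_eq_norm_sq,
          Real.sqrt_sq (norm_nonneg _)]⟩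
  exact ⟨fun n => (hfin n).toFinset, fun n y => by simp⟩

variable [MeasurableSpace E] [BorelSpace E]

theorem card_norm_shell {M : Submodule ℤ E} (hM : EvenUnimodular M)
    (hrank : Module.finrank ℝ E = 24) (hroots : ∀ x ∈ M, ⟪x, x⟫ ≠ 2) {S : ℕ → Finset E}
    (hS : ∀ n y, y ∈ S n ↔ y ∈ M ∧ ⟪y, y⟫ = 2 * n) :
    (S 2).card = 196560 ∧ (S 3).card = 16773120 ∧ (S 4).card = 398034000 := by
  obtain ⟨f, hf⟩ := hM.exists_modularForm_qExpansion_coeff hrank (P := fun _ => 1) (K := 1)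
    (j := 0) (k := 12) continuous_const (by simp)
    (fun τ hτ w => by simpa using fourier_exp_pi_mul_I hrank hτ w) hS
  have hf : ∀ m, (UpperHalfPlane.qExpansion 1 f).coeff m = (S m).card := fun m => by
    rw [hf]; simp
  have hS0 : S 0 = {0} := by
    ext y
    rw [hS, Finset.mem_singleton]
    refine ⟨fun h => by simpa using h.2, ?_⟩
    rintro rfl
    simp
  have hS1 : S 1 = ∅ := by
    ext y
    rw [hS]
    simpa using hroots y
  obtain ⟨h2, h3, h4⟩ := f.qExpansion_coeff_of_weight_twelve (by simp [hf, hS0])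
    (by simp [hf, hS1])
  rw [hf] at h2 h3 h4
  exact ⟨by exact_mod_cast h2, by exact_mod_cast h3, by exact_mod_cast h4⟩

theorem sum_inner_sq_eq_of_norm_eq {M : Submodule ℤ E} (hM : EvenUnimodular M)
    (hrank : Module.finrank ℝ E = 24) {S : ℕ → Finset E}
    (hS : ∀ n y, y ∈ S n ↔ y ∈ M ∧ ⟪y, y⟫ = 2 * n) (m : ℕ) {a b : E} (hab : ‖a‖ = ‖b‖) :
    ∑ y ∈ S m, ⟪y, a⟫ ^ 2 = ∑ y ∈ S m, ⟪y, b⟫ ^ 2 := by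
  let Q : E → E → ℂ := fun c v => (⟪v, c⟫ : ℂ) * (⟪v, c⟫ : ℂ)
  have hQc : ∀ c, Continuous (Q c) := fun c => by fun_prop
  have hQ : ∀ c v, ‖Q c v‖ ≤ ‖c‖ ^ 2 * (1 + ‖v‖) ^ 2 := fun c v => by
    rw [norm_mul, ← sq, ← mul_pow]
    exact pow_le_pow_left₀ (norm_nonneg _) (norm_inner_ofReal_le v c) 2
  obtain ⟨f, hf⟩ := hM.exists_modularForm_qExpansion_coeff hrank (P := fun v => Q a v - Q b v)
    (K := ‖a‖ ^ 2 + ‖b‖ ^ 2) (j := 2) (k := 14) (by fun_prop)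
    (fun v => (norm_sub_le _ _).trans
      ((add_le_add (hQ a v) (hQ b v)).trans_eq (add_mul _ _ _).symm))
    (fun τ hτ w => by
      have ha := integrable_norm_pow_mul_gaussian (hQc a) (hQ a) hτ
      have hb := integrable_norm_pow_mul_gaussian (hQc b) (hQ b) hτ
      have hFa := fourier_inner_sq_mul_exp hrank hτ a w
      have hFb := fourier_inner_sq_mul_exp hrank hτ b w
      simp only [← mul_assoc] at hFa hFb
      have hsub : ∀ {g h : E → ℂ}, Integrable g → Integrable h →
          𝓕 (fun v => g v - h v) w = 𝓕 g w - 𝓕 h w := by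
        intro g h hg hh
        rw [Real.fourier_eq, Real.fourier_eq, Real.fourier_eq, ← integral_sub
          ((Real.fourierIntegral_convergent_iff w).2 hg)
          ((Real.fourierIntegral_convergent_iff w).2 hh)]
        simp only [smul_sub]
      simp only [sub_mul]
      rw [hsub ha hb, hFa, hFb, hab]
      simp only [Q]
      ring) hS
  have hz := f.qExpansion_eq_zero_of_weight_fourteen (by
    rw [hf]
    refine Finset.sum_eq_zero fun y hy => ?_
    have : y = 0 := by simpa using ((hS 0 y).1 hy).2
    simp [Q, this])
  have hm := hf m
  rw [hz, map_zero, Finset.sum_sub_distrib, eq_comm, sub_eq_zero] at hm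
  simp only [Q, ← sq] at hm
  exact_mod_cast hm

theorem exists_sum_inner_sq_eq {M : Submodule ℤ E} (hM : EvenUnimodular M)
    (hrank : Module.finrank ℝ E = 24) {S : ℕ → Finset E}
    (hS : ∀ n y, y ∈ S n ↔ y ∈ M ∧ ⟪y, y⟫ = 2 * n) (m : ℕ) :
    ∃ C : ℝ, ∀ a, ∑ y ∈ S m, ⟪y, a⟫ ^ 2 = C * ⟪a, a⟫ := by
  have : Nontrivial E := Module.nontrivial_of_finrank_pos (R := ℝ) (by omega)
  obtain ⟨e, he⟩ := exists_norm_eq E zero_le_one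
  refine ⟨∑ y ∈ S m, ⟪y, e⟫ ^ 2, fun a => ?_⟩
  rw [hM.sum_inner_sq_eq_of_norm_eq hrank hS m (b := ‖a‖ • e) (by simp [norm_smul, he]),
    Finset.sum_mul]
  refine Finset.sum_congr rfl fun y _ => ?_
  rw [real_inner_smul_right, real_inner_self_eq_norm_sq]
  ring

end EvenUnimodular

theorem EvenUnimodular.covering_radius_sq_le_two_of_finrank_eq
    {E : Type*} [NormedAddCommGroup E] [InnerProductSpace ℝ E] {M : Submodule ℤ E}
    (hM : EvenUnimodular M) (hrank : Module.finrank ℝ E = 24) (hroots : ∀ x ∈ M, ⟪x, x⟫ ≠ 2)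
    (x : E) : ∃ l ∈ M, ⟪x - l, x - l⟫ ≤ 2 := by
  have : FiniteDimensional ℝ E := Module.finite_of_finrank_pos (by omega)
  borelize E
  obtain ⟨S, hS⟩ := hM.exists_finset_norm_shell
  obtain ⟨h2, h3, h4⟩ := hM.card_norm_shell hrank hroots hS
  refine hM.exists_inner_sub_le_two hroots
    (fun y hy => hM.exists_short_of_card hrank hroots S hS h2 h3 h4 hy) (fun N hN R hR => ?_) x
  obtain ⟨T, hT⟩ := hN.exists_finset_norm_shell
  obtain rfl : R = T 1 := by ext y; rw [hR, hT]; simp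
  exact hN.exists_sum_inner_sq_eq hrank hT 1

section

variable {V : Type*} [AddCommGroup V] [Module ℝ V]

theorem tendsto_floor_mul_div_atTop (a : ℝ) :
    Filter.Tendsto (fun n : ℕ => (⌊((n : ℝ) + 1) * a⌋ : ℝ) / (n + 1)) Filter.atTop (nhds a) := by
  have h : Filter.Tendsto (fun n : ℕ => a - 1 / ((n : ℝ) + 1)) Filter.atTop (nhds a) := by
    simpa using tendsto_const_nhds.sub (tendsto_one_div_add_atTop_nhds_zero_nat (𝕜 := ℝ))
  refine tendsto_of_tendsto_of_tendsto_of_le_of_le h tendsto_const_nhds (fun n => ?_) fun n => ?_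
  · have hn : (0 : ℝ) < n + 1 := by positivity
    have := Int.lt_floor_add_one (((n : ℝ) + 1) * a)
    change a - 1 / ((n : ℝ) + 1) ≤ (⌊((n : ℝ) + 1) * a⌋ : ℝ) / (n + 1)
    rw [sub_le_iff_le_add, ← add_div, le_div_iff₀ hn]
    linarith
  · have hn : (0 : ℝ) < n + 1 := by positivity
    have := Int.floor_le (((n : ℝ) + 1) * a)
    change (⌊((n : ℝ) + 1) * a⌋ : ℝ) / (n + 1) ≤ a
    rw [div_le_iff₀ hn]
    linarith

theorem LinearMap.apply_self_nonneg_of_span_int [Module.Finite ℝ V] {L : Submodule ℤ V}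
    (hspan : Submodule.span ℝ (L : Set V) = ⊤) (B : V →ₗ[ℝ] V →ₗ[ℝ] ℝ)
    (hpos : ∀ x ∈ L, 0 ≤ B x x) (x : V) : 0 ≤ B x x := by
  obtain ⟨ι, b, hb⟩ : ∃ (ι : Type _) (b : Module.Basis ι ℝ V), ∀ i, b i ∈ L :=
    ⟨_, Module.Basis.ofSpan hspan.ge, fun i => Module.Basis.ofSpan_subset hspan.ge ⟨i, rfl⟩⟩
  have := Module.Finite.finite_basis b
  have := Fintype.ofFinite ι
  let Q : (ι → ℝ) → ℝ := fun c => B (∑ i, c i • b i) (∑ i, c i • b i)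
  have hQ : Continuous Q := by
    simp only [Q, map_sum, map_smul, LinearMap.sum_apply, LinearMap.smul_apply]
    fun_prop
  have hlim := (hQ.tendsto (b.repr x)).comp
    (tendsto_pi_nhds.2 fun i => tendsto_floor_mul_div_atTop (b.repr x i))
  have hx : Q (b.repr x) = B x x := by simp only [Q, b.sum_repr]
  rw [hx] at hlim
  refine ge_of_tendsto' hlim fun n => ?_
  have hl : ∑ i, ⌊((n : ℝ) + 1) * b.repr x i⌋ • b i ∈ L :=
    sum_mem fun i _ => L.smul_mem _ (hb i)
  have hsum : ∑ i, ((⌊((n : ℝ) + 1) * b.repr x i⌋ : ℝ) / (n + 1)) • b i =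
      ((n : ℝ) + 1)⁻¹ • ∑ i, ⌊((n : ℝ) + 1) * b.repr x i⌋ • b i := by
    rw [Finset.smul_sum]
    refine Finset.sum_congr rfl fun i _ => ?_
    rw [← Int.cast_smul_eq_zsmul ℝ, smul_smul, div_eq_inv_mul]
  simp only [Function.comp_apply, Q, hsum, map_smul, LinearMap.smul_apply, smul_eq_mul]
  have := hpos _ hl
  positivity

theorem LinearMap.apply_eq_zero_of_apply_self_eq_zero {B : V →ₗ[ℝ] V →ₗ[ℝ] ℝ}
    (hsymm : ∀ x y : V, B x y = B y x) (hB : ∀ x, 0 ≤ B x x) {x : V} (hx : B x x = 0) (y : V) :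
    B x y = 0 := by
  by_contra h
  have h1 := hB (y + (-(B y y + 1) / (2 * B x y)) • x)
  simp only [map_add, map_smul, LinearMap.add_apply, LinearMap.smul_apply, smul_eq_mul, hx,
    hsymm y x] at h1
  have h2 : -(B y y + 1) / (2 * B x y) * B x y = -(B y y + 1) / 2 := by field_simp
  rw [h2] at h1
  linarith

end

end

/-- Every Niemeier lattice `Λ` with no roots (i.e. the Leech lattice) has covering radius at
most `√2`: every point of `Λ ⊗ ℝ` is within squared distance 2 of a lattice point. -/
theorem leech_covering_radius_le_sqrt_two
    (V : Type*) [AddCommGroup V] [Module ℝ V]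
    (L : Submodule ℤ V) (hfg : L.FG)
    (hspan : Submodule.span ℝ (L : Set V) = ⊤)
    (hrank : Module.finrank ℝ V = 24)
    (B : V →ₗ[ℝ] V →ₗ[ℝ] ℝ)
    (hsymm : ∀ x y : V, B x y = B y x)
    (hint : ∀ x ∈ L, ∀ y ∈ L, ∃ n : ℤ, B x y = (n : ℝ))
    (hpos : ∀ x ∈ L, x ≠ 0 → 0 < B x x)
    (heven : ∀ x ∈ L, ∃ n : ℤ, B x x = 2 * (n : ℝ))
    (hunimod : ∀ v : V, (∀ y ∈ L, ∃ n : ℤ, B v y = (n : ℝ)) → v ∈ L)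
    (hnoroots : ∀ x ∈ L, B x x ≠ 2) :
    ∀ x : V, ∃ l ∈ L, B (x - l) (x - l) ≤ 2 := by
  have : Module.Finite ℝ V := Module.finite_of_finrank_pos (by omega)
  have hnonneg : ∀ x, 0 ≤ B x x := B.apply_self_nonneg_of_span_int hspan fun x hx => by
    rcases eq_or_ne x 0 with rfl | h
    · simp
    · exact (hpos x hx h).le
  have hdef : ∀ x, B x x = 0 → x = 0 := fun x hx => by
    by_contra h
    refine (hpos x (hunimod x fun y _ => ⟨0, ?_⟩) h).ne' hx
    rw [LinearMap.apply_eq_zero_of_apply_self_eq_zero hsymm hnonneg hx y, Int.cast_zero]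
  let core : InnerProductSpace.Core ℝ V :=
    { inner := fun x y => B x y
      conj_inner_symm := fun x y => hsymm y x
      re_inner_nonneg := hnonneg
      add_left := fun x y z => by simp
      smul_left := fun x y r => by simp
      definite := hdef }
  let _ : NormedAddCommGroup V := core.toNormedAddCommGroup
  let _ : InnerProductSpace ℝ V := InnerProductSpace.ofCore core.toCore
  exact EvenUnimodular.covering_radius_sq_le_two_of_finrank_eq (M := L)
    ⟨hspan, heven, fun x hx => hunimod x hx⟩ hrank hnoroots
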